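/- Let r ≥ 2 be an integer and let p be a prime with p > 10. Then 9·σ_9^{(1)}(2p^r, p) + 36·σ_9^{(2)}(2p^r, p) + 84·σ_9^{(3)}(2p^r, p) + 126·σ_9^{(4)}(2p^r, p) ≡ 16·(2283·B_{p−9} + 7·B_{p−3}^3)·p^{r−1} (mod p^r). -/

import Mathlib

open Finset

attribute [local instance] Classical.propDecidable

/-- `x ≡ y (mod p^s)` for rational numbers `x, y`: the `p`-adic valuation of `x - y`
is at least `s` (where the valuation of `0` is regarded as `+∞`). -/
def padicCong (p s : ℕ) (x y : ℚ) : Prop :=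
  x = y ∨ (s : ℤ) ≤ padicValRat p (x - y)

/-- `Z_n(N,p)`: the sum of `1/(l₁⋯lₙ)` over all ordered `n`-tuples `(l₁,…,lₙ)` of
positive integers not divisible by `p` with `l₁+⋯+lₙ = N`. -/
noncomputable def Zsum (p n N : ℕ) : ℚ :=
  ∑ l ∈ (Finset.Nat.antidiagonalTuple n N).filter
      (fun l => ∀ i, 0 < l i ∧ ¬ p ∣ l i),
    ∏ i, (l i : ℚ)⁻¹

/-- `S_n^{(m)}(p^r)`: the sum of `1/(l₁⋯lₙ)` over all ordered `n`-tuples `(l₁,…,lₙ)` of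
positive integers not divisible by `p`, each `< p^r`, with `l₁+⋯+lₙ = m·p^r`. -/
noncomputable def Ssum (p n m r : ℕ) : ℚ :=
  ∑ l ∈ (Finset.Nat.antidiagonalTuple n (m * p ^ r)).filter
      (fun l => ∀ i, (0 < l i ∧ ¬ p ∣ l i) ∧ l i < p ^ r),
    ∏ i, (l i : ℚ)⁻¹

/-- `σ_n^{(b)}(N,p)`: the sum of `(-1)^(l₁+⋯+l_b)/(l₁⋯lₙ)` over all ordered `n`-tuples
`(l₁,…,lₙ)` of positive integers not divisible by `p` with `l₁+⋯+lₙ = N`. -/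
noncomputable def sigmaSum (p n b N : ℕ) : ℚ :=
  ∑ l ∈ (Finset.Nat.antidiagonalTuple n N).filter
      (fun l => ∀ i, 0 < l i ∧ ¬ p ∣ l i),
    (-1 : ℚ) ^ (∑ i ∈ univ.filter (fun i : Fin n => (i : ℕ) < b), l i) *
      ∏ i, (l i : ℚ)⁻¹

/-- The value of a finite tuple at position `j`, extended by `0`. -/
noncomputable def seqAt {k : ℕ} (u : Fin k → ℕ) (j : ℕ) : ℕ :=
  if h : j < k then u ⟨j, h⟩ else 0

/-- The chain `i₁, i₂, …, i_d, l₁+⋯+l_a` (indexed from `0`): position `j < d` gives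
`i_{j+1}` and position `d` (or beyond) gives `l₁+⋯+l_a`. -/
noncomputable def Fchain {d a : ℕ} (i : Fin d → ℕ) (l : Fin a → ℕ) : ℕ → ℕ :=
  fun j => if h : j < d then i ⟨j, h⟩ else ∑ k, l k

/-- The summation conditions for `F_a^{(b)}(s,N,p)`:
`N > i₁ > ⋯ > i_d > l₁+⋯+l_a`, each `l_k ∈ 𝒫_p`, and
`i₁, i₁-i₂, …, i_{d-1}-i_d, i_d-(l₁+⋯+l_a) ∈ 𝒫_p`.
(When `d = 0` this reduces to `l₁+⋯+l_a < N` and each `l_k ∈ 𝒫_p`.) -/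
def FCond (p : ℕ) {d a : ℕ} (i : Fin d → ℕ) (l : Fin a → ℕ) (N : ℕ) : Prop :=
  (∀ k, 0 < l k ∧ ¬ p ∣ l k) ∧
  Fchain i l 0 < N ∧
  (0 < d → 0 < Fchain i l 0 ∧ ¬ p ∣ Fchain i l 0) ∧
  ∀ j < d, Fchain i l (j + 1) < Fchain i l j ∧
    0 < Fchain i l j - Fchain i l (j + 1) ∧ ¬ p ∣ (Fchain i l j - Fchain i l (j + 1))

/-- `F_a^{(b)}(s,N,p)` where `s = (s₁,…,s_d)` is a vector of signs. -/
noncomputable def Fsum (p a b : ℕ) {d : ℕ} (s : Fin d → ℤ) (N : ℕ) : ℚ :=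
  ∑ il ∈ ((Fintype.piFinset fun _ : Fin d => Finset.range N) ×ˢ
          (Fintype.piFinset fun _ : Fin a => Finset.range N)).filter
      (fun il => FCond p il.1 il.2 N),
    (∏ j, (s j : ℚ) ^ il.1 j) *
      (-1 : ℚ) ^ (∑ k ∈ univ.filter (fun k : Fin a => (k : ℕ) < b), il.2 k) /
      ((∏ j, (il.1 j : ℚ)) * ∏ k, (il.2 k : ℚ))

/-- `A_s`: the total size of the odd-indexed blocks in the decomposition
`s = (X_{w₁}, Z_{w₂}, …, Z_{w_l})`; equivalently, the number of positions `j` such that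
the number of `-1`-entries among `s₁,…,s_j` is even. -/
noncomputable def Acount {d : ℕ} (s : Fin d → ℤ) : ℕ :=
  (univ.filter fun j : Fin d =>
    Even (univ.filter (fun k : Fin d => k ≤ j ∧ s k = -1)).card).card

/-- `B_s`: the total size of the even-indexed blocks in the decomposition
`s = (X_{w₁}, Z_{w₂}, …, Z_{w_l})`; equivalently, the number of positions `j` such that
the number of `-1`-entries among `s₁,…,s_j` is odd. -/
noncomputable def Bcount {d : ℕ} (s : Fin d → ℤ) : ℕ :=
  (univ.filter fun j : Fin d =>
    Odd (univ.filter (fun k : Fin d => k ≤ j ∧ s k = -1)).card).card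

/-- `len(W_s)`: the number of blocks, namely `1` plus the number of `-1`-entries of `s`. -/
noncomputable def lenW {d : ℕ} (s : Fin d → ℤ) : ℕ :=
  1 + (univ.filter fun k : Fin d => s k = -1).card

/-- `P_s` (for given `a ≥ b`): `a - b - A_s` if `len(W_s)` is even, `b - B_s` if odd.
For `s = ∅` this gives `P_∅ = b`. -/
noncomputable def Pval (a b : ℕ) {d : ℕ} (s : Fin d → ℤ) : ℕ :=
  if 2 ∣ lenW s then a - b - Acount s else b - Bcount s

/-- `C_{a,b}(A,B)`, defined via falling factorials `(x)_γ = x(x-1)⋯(x-γ+1)`. -/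
def Cab (a b A B : ℕ) : ℚ :=
  if A = 0 ∧ B = 0 then 1
  else if A = 0 then (b.descFactorial B : ℚ)
  else if B = 0 then ((a - b).descFactorial A : ℚ)
  else ((a - b).descFactorial A : ℚ) * (b.descFactorial B : ℚ)

section basics
variable {p : ℕ} [Fact p.Prime]

/-- Inverse of a natural number in the p-adic integers (zero if divisible by p). -/
noncomputable def iv (p : ℕ) [Fact p.Prime] (n : ℕ) : ℤ_[p] := Ring.inverse (n : ℤ_[p])

lemma isUnit_nat_iff (n : ℕ) : IsUnit (n : ℤ_[p]) ↔ ¬ p ∣ n := by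
  rw [PadicInt.isUnit_iff, PadicInt.norm_natCast_eq_one_iff]
  exact Nat.Prime.coprime_iff_not_dvd Fact.out

lemma mul_iv {n : ℕ} (h : ¬ p ∣ n) : (n : ℤ_[p]) * iv p n = 1 :=
  Ring.mul_inverse_cancel _ ((isUnit_nat_iff n).2 h)

lemma iv_of_dvd {n : ℕ} (h : p ∣ n) : iv p n = 0 :=
  Ring.inverse_non_unit _ (by rw [isUnit_nat_iff]; simpa using h)

lemma iv_zero : iv p 0 = 0 := iv_of_dvd (dvd_zero p)

lemma iv_congr {q : ℕ} (hq : p ∣ q) (a k : ℕ) :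
    ∃ z : ℤ_[p], iv p (a + q * k) = iv p a - q * (k * iv p a ^ 2) + (q : ℤ_[p]) ^ 2 * z := by
  by_cases h : p ∣ a
  · refine ⟨0, ?_⟩
    rw [iv_of_dvd h, iv_of_dvd (dvd_add h (Dvd.dvd.mul_right hq k))]; ring
  · have h' : ¬ p ∣ a + q * k := by
      rwa [← Nat.dvd_add_iff_left (Dvd.dvd.mul_right hq k)]
    have h1 := mul_iv h
    have h2 := mul_iv h'
    push_cast at h2
    set u := iv p (a + q * k)
    set v := iv p a
    refine ⟨k ^ 2 * u * v ^ 2, ?_⟩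
    have e : u - v = - (q * k * u * v) := by
      linear_combination (-u) * h1 + v * h2
    linear_combination (1 - q * k * v) * e

/-- cancel a unit natural number -/
lemma dvd_of_nat_mul {n : ℕ} (hn : ¬ p ∣ n) {a x : ℤ_[p]} (h : a ∣ n * x) : a ∣ x :=
  (IsUnit.dvd_mul_left ((isUnit_nat_iff n).2 hn)).1 h

/-- the generating series, p-adically -/
noncomputable def Fser (p : ℕ) [Fact p.Prime] : PowerSeries ℤ_[p] := PowerSeries.mk (iv p)

/-- the generating series, over the rationals -/
noncomputable def FQ (p : ℕ) : PowerSeries ℚ :=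
  PowerSeries.mk fun l => if p ∣ l then 0 else (l : ℚ)⁻¹

/-- the alternating generating series, over the rationals -/
noncomputable def FQn (p : ℕ) : PowerSeries ℚ :=
  PowerSeries.mk fun l => (-1) ^ l * if p ∣ l then 0 else (l : ℚ)⁻¹

lemma iv_coe (n : ℕ) : ((iv p n : ℤ_[p]) : ℚ_[p]) = if p ∣ n then 0 else (n : ℚ_[p])⁻¹ := by
  split_ifs with h
  · simp [iv_of_dvd h]
  · have := congrArg (fun x : ℤ_[p] => (x : ℚ_[p])) (mul_iv h)
    simp only [PadicInt.coe_mul, PadicInt.coe_natCast, PadicInt.coe_one] at this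
    exact eq_inv_of_mul_eq_one_right this

lemma coeff_FQ_pow_coe (k N : ℕ) :
    ((PowerSeries.coeff N (FQ p ^ k) : ℚ) : ℚ_[p]) =
      ((PowerSeries.coeff N (Fser p ^ k) : ℤ_[p]) : ℚ_[p]) := by
  have h : PowerSeries.map (algebraMap ℚ ℚ_[p]) (FQ p) =
      PowerSeries.map (algebraMap ℤ_[p] ℚ_[p]) (Fser p) := by
    ext n
    simp only [PowerSeries.coeff_map, FQ, Fser, PowerSeries.coeff_mk,
      PadicInt.algebraMap_apply, iv_coe]
    split_ifs <;> simp
  have h2 := congrArg (fun f => PowerSeries.coeff N (f ^ k)) h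
  simp only [← map_pow, PowerSeries.coeff_map, PadicInt.algebraMap_apply] at h2
  simpa using h2

lemma padicCong_of_dvd {r : ℕ} {x y : ℚ} {X Y : ℤ_[p]} (hx : (x : ℚ_[p]) = X)
    (hy : (y : ℚ_[p]) = Y) (h : (p : ℤ_[p]) ^ r ∣ X - Y) : padicCong p r x y := by
  by_cases hxy : x = y
  · exact Or.inl hxy
  right
  have hne : X - Y ≠ 0 := by
    intro h0
    apply hxy
    have : X = Y := sub_eq_zero.1 h0
    rw [this, ← hy] at hx
    exact_mod_cast hx
  have h1 := (PadicInt.mem_span_pow_iff_le_valuation _ hne r).1 (Ideal.mem_span_singleton.2 h)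
  have h2 : ((x - y : ℚ) : ℚ_[p]) = ((X - Y : ℤ_[p]) : ℚ_[p]) := by
    push_cast; rw [hx, hy]
  have h3 := congrArg Padic.valuation h2
  rw [Padic.valuation_ratCast, PadicInt.valuation_coe] at h3
  rw [h3]; exact_mod_cast h1

end basics

section sigma

lemma coeff_prod_fin {R : Type*} [CommRing R] (n N : ℕ) (f : Fin n → PowerSeries R) :
    PowerSeries.coeff N (∏ i, f i) =
      ∑ l ∈ Finset.Nat.antidiagonalTuple n N, ∏ i, PowerSeries.coeff (l i) (f i) := by
  rw [PowerSeries.coeff_prod]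
  refine Finset.sum_bij (fun l _ => (l : Fin n → ℕ)) ?_ ?_ ?_ ?_
  · intro l hl
    rw [Finset.mem_finsuppAntidiag] at hl
    rw [Finset.Nat.mem_antidiagonalTuple]
    exact hl.1
  · intro a _ b _ h
    exact DFunLike.coe_injective h
  · intro b hb
    rw [Finset.Nat.mem_antidiagonalTuple] at hb
    refine ⟨Finsupp.equivFunOnFinite.symm b, ?_, by simp⟩
    rw [Finset.mem_finsuppAntidiag]
    exact ⟨by simpa using hb, by simp⟩
  · intro a _; rfl

lemma sigma_eq (p b N : ℕ) :
    sigmaSum p 9 b N = PowerSeries.coeff N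
      (∏ i : Fin 9, if (i : ℕ) < b then FQn p else FQ p) := by
  rw [coeff_prod_fin, sigmaSum, Finset.sum_filter]
  refine Finset.sum_congr rfl fun l _ => ?_
  have hc : ∀ i : Fin 9, PowerSeries.coeff (l i) (if (i : ℕ) < b then FQn p else FQ p) =
      (if (i : ℕ) < b then (-1 : ℚ) ^ l i else 1) * if p ∣ l i then 0 else (l i : ℚ)⁻¹ := by
    intro i
    split_ifs <;> simp_all [FQ, FQn]
  rw [Finset.prod_congr rfl fun i _ => hc i, Finset.prod_mul_distrib]
  rw [← Finset.prod_filter, Finset.prod_pow_eq_pow_sum]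
  split_ifs with h
  · congr 1
    refine Finset.prod_congr rfl fun i _ => ?_
    rw [if_neg (h i).2]
  · push Not at h
    obtain ⟨i, hi⟩ := h
    have hp : p ∣ l i := by
      by_cases h0 : 0 < l i
      · exact hi h0
      · have : l i = 0 := by omega
        simp [this]
    rw [Finset.prod_eq_zero (Finset.mem_univ i), mul_zero]
    rw [if_pos hp]

lemma sigma_pow (p b N : ℕ) (hb : b < 5) :
    sigmaSum p 9 b N = PowerSeries.coeff N (FQn p ^ b * FQ p ^ (9 - b)) := by
  rw [sigma_eq]
  congr 1
  interval_cases b <;> simp [Fin.prod_univ_succ] <;> ring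

lemma FQn_eq (p : ℕ) : FQn p = PowerSeries.rescale (-1) (FQ p) := by
  ext n; simp [FQn, FQ, PowerSeries.coeff_rescale]

lemma FQ_eq (p : ℕ) : FQ p = PowerSeries.rescale (-1) (FQn p) := by
  ext n; simp only [FQn, FQ, PowerSeries.coeff_rescale, PowerSeries.coeff_mk, ← mul_assoc]
  rw [← mul_pow]; simp

lemma coeff_sym (p a b M : ℕ) :
    PowerSeries.coeff (2 * M) (FQn p ^ a * FQ p ^ b) =
      PowerSeries.coeff (2 * M) (FQn p ^ b * FQ p ^ a) := by
  have h : FQn p ^ b * FQ p ^ a = PowerSeries.rescale (-1) (FQn p ^ a * FQ p ^ b) := by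
    rw [map_mul, map_pow, map_pow, ← FQn_eq, ← FQ_eq]; ring
  rw [h, PowerSeries.coeff_rescale]; simp [pow_mul]

lemma FQ_add (p : ℕ) (hp : p.Prime) (h2 : p ≠ 2) :
    FQn p + FQ p = PowerSeries.expand 2 two_ne_zero (FQ p) := by
  ext n
  rw [PowerSeries.coeff_expand]
  split_ifs with h
  · obtain ⟨m, rfl⟩ := h
    have hd : p ∣ 2 * m ↔ p ∣ m := by
      rw [hp.dvd_mul]
      constructor
      · rintro (h | h)
        · exact absurd ((Nat.prime_dvd_prime_iff_eq hp Nat.prime_two).1 h) h2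
        · exact h
      · exact Or.inr
    simp only [map_add, FQn, FQ, PowerSeries.coeff_mk, hd]
    rw [Nat.mul_div_cancel_left _ (by norm_num : 0 < 2)]
    split_ifs
    · simp
    · simp [pow_mul]; ring
  · have : Odd n := by rwa [← Nat.not_even_iff_odd, even_iff_two_dvd]
    simp only [map_add, FQn, FQ, PowerSeries.coeff_mk, this.neg_one_pow]
    ring

lemma sigma_total (p M : ℕ) (hp : p.Prime) (h2 : p ≠ 2) :
    2 * (9 * sigmaSum p 9 1 (2 * M) + 36 * sigmaSum p 9 2 (2 * M) +
        84 * sigmaSum p 9 3 (2 * M) + 126 * sigmaSum p 9 4 (2 * M)) =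
    PowerSeries.coeff M (FQ p ^ 9) - 2 * PowerSeries.coeff (2 * M) (FQ p ^ 9) := by
  have h : PowerSeries.coeff (2 * M) ((FQn p + FQ p) ^ 9) = PowerSeries.coeff M (FQ p ^ 9) := by
    rw [FQ_add p hp h2, ← map_pow, PowerSeries.coeff_expand, if_pos (Dvd.intro _ rfl),
      Nat.mul_div_cancel_left _ (by norm_num : 0 < 2)]
  rw [← h, add_pow, map_sum]
  simp only [sigma_pow p _ _ (by norm_num : 1 < 5), sigma_pow p _ _ (by norm_num : 2 < 5),
    sigma_pow p _ _ (by norm_num : 3 < 5), sigma_pow p _ _ (by norm_num : 4 < 5)]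
  have hc : ∀ (f : PowerSeries ℚ) (c : ℕ), PowerSeries.coeff (2 * M) (f * (c : PowerSeries ℚ)) =
      c * PowerSeries.coeff (2 * M) f := by
    intro f c
    rw [mul_comm f, ← nsmul_eq_mul, map_nsmul, nsmul_eq_mul]
  simp only [hc, Finset.sum_range_succ, Finset.sum_range_zero]
  rw [coeff_sym p 5, coeff_sym p 6, coeff_sym p 7, coeff_sym p 8, coeff_sym p 9]
  norm_num [Nat.choose]
  ring

end sigma

section lifting
variable {p : ℕ} [Fact p.Prime]

lemma coeff_mul_expand {R : Type*} [CommRing R] (q : ℕ) (hq : q ≠ 0) (u v : PowerSeries R)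
    (N : ℕ) : PowerSeries.coeff N (u * PowerSeries.expand q hq v) =
      ∑ j ∈ range (N / q + 1), PowerSeries.coeff (N - q * j) u * PowerSeries.coeff j v := by
  rw [mul_comm, PowerSeries.coeff_mul, Finset.Nat.sum_antidiagonal_eq_sum_range_succ_mk]
  simp only [PowerSeries.coeff_expand, ite_mul, zero_mul]
  rw [← Finset.sum_filter]
  symm
  refine Finset.sum_bij (fun j _ => q * j) ?_ ?_ ?_ ?_
  · intro j hj
    simp only [mem_range, mem_filter] at hj ⊢
    have h1 : j ≤ N / q := by omega
    have h2 : q * j ≤ N := le_trans (Nat.mul_le_mul_left q h1) (Nat.mul_div_le N q)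
    exact ⟨by omega, Dvd.intro _ rfl⟩
  · intro a _ b _ h
    exact Nat.eq_of_mul_eq_mul_left (Nat.pos_of_ne_zero hq) h
  · intro b hb
    simp only [mem_range, mem_filter] at hb
    obtain ⟨hb, j, rfl⟩ := hb
    refine ⟨j, ?_, rfl⟩
    have : j ≤ N / q := by
      rw [Nat.le_div_iff_mul_le (Nat.pos_of_ne_zero hq), mul_comm]; omega
    simp only [mem_range]; omega
  · intro j _
    rw [Nat.mul_div_cancel_left _ (Nat.pos_of_ne_zero hq), mul_comm]

lemma coeff_mul_expand_choose {R : Type*} [CommRing R] (q : ℕ) (hq : q ≠ 0)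
    (u v : PowerSeries R) (d : ℕ) (hd : 8 ≤ d)
    (hv : ∀ k, PowerSeries.coeff k v = ((k + 8).choose d : R))
    (h0 : PowerSeries.coeff 0 u = 0) (h9 : ∀ s, 9 ≤ s → PowerSeries.coeff (s * q) u = 0) (m : ℕ) :
    PowerSeries.coeff (m * q) (u * PowerSeries.expand q hq v) =
      ∑ s ∈ range 8, PowerSeries.coeff ((s + 1) * q) u * ((m + 7 - s).choose d : R) := by
  have hw : PowerSeries.coeff (m * q) (u * PowerSeries.expand q hq v) =
      ∑ s ∈ range (m + 1), PowerSeries.coeff (s * q) u * ((m + 8 - s).choose d : R) := by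
    rw [coeff_mul_expand, Nat.mul_div_cancel _ (Nat.pos_of_ne_zero hq),
      ← Finset.sum_range_reflect]
    refine Finset.sum_congr rfl fun s hs => ?_
    simp only [mem_range] at hs
    have e1 : m * q - q * (m + 1 - 1 - s) = s * q := by
      obtain ⟨t, rfl⟩ : ∃ t, m = s + t := ⟨m - s, by omega⟩
      have : s + t + 1 - 1 - s = t := by omega
      rw [this, add_mul, mul_comm q t]; omega
    have e2 : m + 1 - 1 - s + 8 = m + 8 - s := by omega
    rw [e1, hv, e2]
  rw [hw]
  have hA : ∑ s ∈ range (m + 1), PowerSeries.coeff (s * q) u * ((m + 8 - s).choose d : R) =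
      ∑ s ∈ range (m + 9), PowerSeries.coeff (s * q) u * ((m + 8 - s).choose d : R) := by
    refine Finset.sum_subset (by intro x; simp only [mem_range]; omega) fun s _ hs => ?_
    simp only [mem_range] at hs
    rw [Nat.choose_eq_zero_of_lt (by omega)]; simp
  have hB : ∑ s ∈ range 9, PowerSeries.coeff (s * q) u * ((m + 8 - s).choose d : R) =
      ∑ s ∈ range (m + 9), PowerSeries.coeff (s * q) u * ((m + 8 - s).choose d : R) := by
    refine Finset.sum_subset (by intro x; simp only [mem_range]; omega) fun s _ hs => ?_
    simp only [mem_range] at hs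
    rw [h9 s (by omega), zero_mul]
  rw [hA, ← hB, Finset.sum_range_succ']
  simp only [zero_mul, h0, add_zero]
  refine Finset.sum_congr rfl fun s _ => ?_
  have : m + 8 - (s + 1) = m + 7 - s := by omega
  rw [this]

/-- truncated series -/
noncomputable def fpoly (p : ℕ) [Fact p.Prime] (e q : ℕ) : Polynomial ℤ_[p] :=
  ∑ a ∈ range q, Polynomial.monomial a (iv p a ^ e)

lemma fpoly_coeff (e q n : ℕ) : (fpoly p e q).coeff n = if n < q then iv p n ^ e else 0 := by
  simp only [fpoly, Polynomial.finsetSum_coeff, Polynomial.coeff_monomial]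
  rw [Finset.sum_ite_eq']
  simp

lemma fpoly_natDegree (e q : ℕ) : (fpoly p e q).natDegree ≤ q - 1 := by
  rw [Polynomial.natDegree_le_iff_coeff_eq_zero]
  intro n hn
  rw [fpoly_coeff, if_neg (by omega)]

lemma geom_coeff (k : ℕ) : PowerSeries.coeff k ((PowerSeries.mk 1 : PowerSeries ℤ_[p]) ^ 9) =
    ((k + 8).choose 8 : ℤ_[p]) := by
  rw [PowerSeries.mk_one_pow_eq_mk_choose_add, PowerSeries.coeff_mk, add_comm]

lemma geom_coeff' (k : ℕ) : PowerSeries.coeff k ((PowerSeries.mk 1 : PowerSeries ℤ_[p]) ^ 8 *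
    (PowerSeries.X * PowerSeries.mk 1 ^ 2)) = ((k + 8).choose 9 : ℤ_[p]) := by
  have : ((PowerSeries.mk 1 : PowerSeries ℤ_[p]) ^ 8 * (PowerSeries.X * PowerSeries.mk 1 ^ 2)) =
    PowerSeries.X * PowerSeries.mk 1 ^ (9 + 1) := by ring
  rw [this, PowerSeries.mk_one_pow_eq_mk_choose_add]
  cases k with
  | zero => simp [Nat.choose]
  | succ k =>
    rw [PowerSeries.coeff_succ_X_mul, PowerSeries.coeff_mk]
    congr 2; omega

lemma coeff_fpoly_expand (e q : ℕ) (hq : q ≠ 0) (v : PowerSeries ℤ_[p]) (n : ℕ) :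
    PowerSeries.coeff n ((fpoly p e q : PowerSeries ℤ_[p]) * PowerSeries.expand q hq v) =
      iv p (n % q) ^ e * PowerSeries.coeff (n / q) v := by
  rw [coeff_mul_expand, Finset.sum_eq_single_of_mem (n / q) (by simp)]
  · have : n - q * (n / q) = n % q := by
      have := Nat.mod_add_div n q; omega
    rw [this, Polynomial.coeff_coe, fpoly_coeff, if_pos (Nat.mod_lt _ (Nat.pos_of_ne_zero hq))]
  · intro j hj hne
    simp only [mem_range] at hj
    rw [Polynomial.coeff_coe, fpoly_coeff, if_neg, zero_mul]
    have h1 : j + 1 ≤ n / q := by omega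
    have h2 := Nat.mul_le_mul_left q h1
    have h3 := Nat.mul_div_le n q
    rw [mul_add] at h2
    omega

lemma Fser_approx (q : ℕ) (hq : q ≠ 0) (hpq : p ∣ q) : ∃ H : PowerSeries ℤ_[p],
    Fser p = (fpoly p 1 q : PowerSeries ℤ_[p]) * PowerSeries.expand q hq (PowerSeries.mk 1) +
      (q : PowerSeries ℤ_[p]) * (-((fpoly p 2 q : PowerSeries ℤ_[p]) *
        PowerSeries.expand q hq (PowerSeries.X * PowerSeries.mk 1 ^ 2)) +
        (q : PowerSeries ℤ_[p]) * H) := by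
  have hz : ∀ n : ℕ, ∃ z : ℤ_[p], iv p n = iv p (n % q) - q * ((n / q : ℕ) * iv p (n % q) ^ 2)
      + (q : ℤ_[p]) ^ 2 * z := by
    intro n
    have := iv_congr (p := p) hpq (n % q) (n / q)
    rwa [Nat.mod_add_div] at this
  choose z hz using hz
  refine ⟨PowerSeries.mk z, ?_⟩
  ext n
  have hc : ∀ (f : PowerSeries ℤ_[p]), PowerSeries.coeff n ((q : PowerSeries ℤ_[p]) * f) =
      q * PowerSeries.coeff n f := by
    intro f
    rw [← nsmul_eq_mul, map_nsmul, nsmul_eq_mul]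
  have hk : ∀ k, PowerSeries.coeff k (PowerSeries.X * PowerSeries.mk 1 ^ 2 : PowerSeries ℤ_[p])
      = k := by
    intro k
    rw [PowerSeries.mk_one_pow_eq_mk_choose_add]
    cases k with
    | zero => simp
    | succ k => rw [PowerSeries.coeff_succ_X_mul, PowerSeries.coeff_mk]; simp [add_comm]
  rw [map_add, coeff_fpoly_expand, hc, map_add, map_neg, coeff_fpoly_expand, hc, hk]
  simp only [Fser, PowerSeries.coeff_mk]
  rw [hz n]; simp; ring

/-- the truncated sums -/
noncomputable def Uc (p : ℕ) [Fact p.Prime] (q s : ℕ) : ℤ_[p] := ((fpoly p 1 q) ^ 9).coeff (s * q)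

lemma lift_formula (q : ℕ) (hq : q ≠ 0) (hpq : p ∣ q) : ∃ V : ℕ → ℤ_[p], ∀ m : ℕ, ∃ z : ℤ_[p],
    PowerSeries.coeff (m * q) (Fser p ^ 9) =
      ∑ s ∈ range 8, Uc p q (s + 1) * ((m + 7 - s).choose 8 : ℤ_[p])
      - 9 * q * ∑ s ∈ range 8, V (s + 1) * ((m + 7 - s).choose 9 : ℤ_[p])
      + (q : ℤ_[p]) ^ 2 * z := by
  obtain ⟨H, hH⟩ := Fser_approx (p := p) q hq hpq
  set a := (fpoly p 1 q : PowerSeries ℤ_[p]) * PowerSeries.expand q hq (PowerSeries.mk 1) with ha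
  set b := (fpoly p 2 q : PowerSeries ℤ_[p]) *
        PowerSeries.expand q hq (PowerSeries.X * PowerSeries.mk 1 ^ 2) with hb
  obtain ⟨k, hk⟩ := Polynomial.powAddExpansion a ((q : PowerSeries ℤ_[p]) * (-b + q * H)) 9
  refine ⟨fun s => ((fpoly p 1 q) ^ 8 * fpoly p 2 q).coeff (s * q), fun m => ?_⟩
  refine ⟨PowerSeries.coeff (m * q) (9 * a ^ 8 * H + k * (-b + q * H) ^ 2), ?_⟩
  have e : Fser p ^ 9 = a ^ 9 - (q : PowerSeries ℤ_[p]) * (9 * (a ^ 8 * b)) +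
      (q : PowerSeries ℤ_[p]) * (q * (9 * a ^ 8 * H + k * (-b + q * H) ^ 2)) := by
    rw [hH, hk]; push_cast; ring
  have hc : ∀ (c : ℕ) (f : PowerSeries ℤ_[p]),
      PowerSeries.coeff (m * q) ((c : PowerSeries ℤ_[p]) * f) =
      c * PowerSeries.coeff (m * q) f := by
    intro c f
    rw [← nsmul_eq_mul, map_nsmul, nsmul_eq_mul]
  have e9 : a ^ 9 = (((fpoly p 1 q) ^ 9 : Polynomial ℤ_[p]) : PowerSeries ℤ_[p]) *
      PowerSeries.expand q hq (PowerSeries.mk 1 ^ 9) := by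
    rw [ha, mul_pow, map_pow, Polynomial.coe_pow]
  have e8 : a ^ 8 * b = (((fpoly p 1 q) ^ 8 * fpoly p 2 q : Polynomial ℤ_[p]) : PowerSeries ℤ_[p]) *
      PowerSeries.expand q hq (PowerSeries.mk 1 ^ 8 * (PowerSeries.X * PowerSeries.mk 1 ^ 2)) := by
    rw [ha, hb, mul_pow]
    simp only [map_mul, map_pow, Polynomial.coe_mul, Polynomial.coe_pow]; ring
  have hq1 : 1 ≤ q := Nat.pos_of_ne_zero hq
  have hdeg : ∀ s, 9 ≤ s → 9 * (q - 1) < s * q := by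
    intro s hs
    have : 9 * q ≤ s * q := Nat.mul_le_mul_right q hs
    omega
  have c0 : ∀ e, e ≠ 0 → (fpoly p e q).coeff 0 = 0 := by
    intro e he; rw [fpoly_coeff, if_pos (show 0 < q from hq1), iv_zero, zero_pow he]
  rw [e, map_add, map_sub, hc, hc, hc, show (9 : PowerSeries ℤ_[p]) = ((9 : ℕ) : PowerSeries ℤ_[p]) by simp, hc, e9, e8,
    coeff_mul_expand_choose q hq _ _ 8 le_rfl geom_coeff,
    coeff_mul_expand_choose q hq _ _ 9 (by norm_num) geom_coeff']
  · simp only [Polynomial.coeff_coe, Uc]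
    push_cast
    ring
  · rw [Polynomial.coeff_coe, Polynomial.mul_coeff_zero, c0 2 (by norm_num), mul_zero]
  · intro s hs
    rw [Polynomial.coeff_coe]
    apply Polynomial.coeff_eq_zero_of_natDegree_lt
    refine lt_of_le_of_lt ?_ (hdeg s hs)
    refine Polynomial.natDegree_mul_le.trans ?_
    have h1 := Polynomial.natDegree_pow_le (p := fpoly p 1 q) (n := 8)
    have h2 := fpoly_natDegree (p := p) 1 q
    have h3 := fpoly_natDegree (p := p) 2 q
    omega
  · rw [Polynomial.coeff_coe, Polynomial.coeff_zero_eq_eval_zero, Polynomial.eval_pow,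
      ← Polynomial.coeff_zero_eq_eval_zero, c0 1 (by norm_num)]; simp
  · intro s hs
    rw [Polynomial.coeff_coe]
    apply Polynomial.coeff_eq_zero_of_natDegree_lt
    refine lt_of_le_of_lt ?_ (hdeg s hs)
    have h1 := Polynomial.natDegree_pow_le (p := fpoly p 1 q) (n := 9)
    have h2 := fpoly_natDegree (p := p) 1 q
    omega

end lifting

section induct
variable {p : ℕ} [Fact p.Prime]

/-- weights -/
def Ew (s : ℕ) : ℤ := (-1) ^ s * ((s.factorial * (7 - s).factorial : ℕ) : ℤ)

lemma dvd_desc (n s d : ℕ) (hs : s < 8) (hd : 8 ≤ d) : n ∣ (n + 7 - s).descFactorial d := by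
  rw [Nat.descFactorial_eq_prod_range]
  have : n = n + 7 - s - (7 - s) := by omega
  conv_lhs => rw [this]
  exact Finset.dvd_prod_of_mem (fun i => n + 7 - s - i) (by simp only [mem_range]; omega)

lemma choose_eight (n s : ℕ) (hn : n = 0 ∨ 8 ≤ n) (hs : s < 8) :
    ∃ w : ℤ, 40320 * ((n + 7 - s).choose 8 : ℤ) = n * (Ew s + n * w) := by
  rcases hn with rfl | hn
  · refine ⟨0, ?_⟩
    rw [Nat.choose_eq_zero_of_lt (by omega)]; simp
  obtain ⟨t, rfl⟩ : ∃ t, n = t + 8 := ⟨n - 8, by omega⟩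
  have h : (40320 * ((t + 8 + 7 - s).choose 8 : ℤ)) = ((t + 8 + 7 - s).descFactorial 8 : ℕ) := by
    rw [Nat.descFactorial_eq_factorial_mul_choose]; push_cast; norm_num [Nat.factorial]
  rw [h]
  have hw : ∃ w : ℤ → ℤ, ∀ n : ℤ, (n + 7 - s) * (n + 6 - s) * (n + 5 - s) * (n + 4 - s) * (n + 3 - s) * (n + 2 - s) * (n + 1 - s) * (n - s) = n * (Ew s + n * w n) := by
    interval_cases s
    · refine ⟨fun n => (13068)*n^0 + (13132)*n^1 + (6769)*n^2 + (1960)*n^3 + (322)*n^4 + (28)*n^5 + (1)*n^6, fun n => ?_⟩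
      norm_num [Ew, Nat.factorial]
      ring
    · refine ⟨fun n => (-1044)*n^0 + (140)*n^1 + (889)*n^2 + (560)*n^3 + (154)*n^4 + (20)*n^5 + (1)*n^6, fun n => ?_⟩
      norm_num [Ew, Nat.factorial]
      ring
    · refine ⟨fun n => (188)*n^0 + (-252)*n^1 + (-231)*n^2 + (0)*n^3 + (42)*n^4 + (12)*n^5 + (1)*n^6, fun n => ?_⟩
      norm_num [Ew, Nat.factorial]
      ring
    · refine ⟨fun n => (-36)*n^0 + (196)*n^1 + (49)*n^2 + (-56)*n^3 + (-14)*n^4 + (4)*n^5 + (1)*n^6, fun n => ?_⟩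
      norm_num [Ew, Nat.factorial]
      ring
    · refine ⟨fun n => (-36)*n^0 + (-196)*n^1 + (49)*n^2 + (56)*n^3 + (-14)*n^4 + (-4)*n^5 + (1)*n^6, fun n => ?_⟩
      norm_num [Ew, Nat.factorial]
      ring
    · refine ⟨fun n => (188)*n^0 + (252)*n^1 + (-231)*n^2 + (0)*n^3 + (42)*n^4 + (-12)*n^5 + (1)*n^6, fun n => ?_⟩
      norm_num [Ew, Nat.factorial]
      ring
    · refine ⟨fun n => (-1044)*n^0 + (-140)*n^1 + (889)*n^2 + (-560)*n^3 + (154)*n^4 + (-20)*n^5 + (1)*n^6, fun n => ?_⟩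
      norm_num [Ew, Nat.factorial]
      ring
    · refine ⟨fun n => (13068)*n^0 + (-13132)*n^1 + (6769)*n^2 + (-1960)*n^3 + (322)*n^4 + (-28)*n^5 + (1)*n^6, fun n => ?_⟩
      norm_num [Ew, Nat.factorial]
      ring
  obtain ⟨w, hw⟩ := hw
  refine ⟨w ((t + 8 : ℕ) : ℤ), ?_⟩
  rw [← hw]
  have e : ∀ k, k < 8 → ((t + 8 + 7 - s - k : ℕ) : ℤ) = ((t + 8 : ℕ) : ℤ) + 7 - s - k := by
    intro k hk; omega
  rw [Nat.descFactorial_eq_prod_range]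
  simp only [Finset.prod_range_succ, Finset.prod_range_zero, Nat.cast_mul, e 0, e 1, e 2, e 3, e 4, e 5, e 6, e 7, (by norm_num : 0 < 8), (by norm_num : 1 < 8), (by norm_num : 2 < 8), (by norm_num : 3 < 8), (by norm_num : 4 < 8), (by norm_num : 5 < 8), (by norm_num : 6 < 8), (by norm_num : 7 < 8)]
  push_cast
  ring

lemma prime_not_dvd_factorial (hp10 : 10 < p) (k : ℕ) (hk : k < 11) : ¬ p ∣ k.factorial := by
  rw [Nat.Prime.dvd_factorial Fact.out]; omega

lemma dvd_choose_nine (hp10 : 10 < p) (m s : ℕ) (hs : s < 8) :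
    (p : ℤ_[p]) ∣ ((p * m + 7 - s).choose 9 : ℤ_[p]) := by
  have h := (Dvd.intro m rfl : p ∣ p * m).trans (dvd_desc (p * m) s 9 hs (by norm_num))
  rw [Nat.descFactorial_eq_factorial_mul_choose] at h
  have h2 := ((Nat.Prime.dvd_mul Fact.out).1 h).resolve_left
    (prime_not_dvd_factorial hp10 9 (by norm_num))
  exact Nat.cast_dvd_cast h2

/-- weighted sum of truncated sums -/
noncomputable def EU (p : ℕ) [Fact p.Prime] (q : ℕ) : ℤ_[p] :=
  ∑ s ∈ range 8, (Ew s : ℤ_[p]) * Uc p q (s + 1)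

lemma lift_step (hp10 : 10 < p) (k m : ℕ) : ∃ w : ℕ → ℤ_[p], (p : ℤ_[p]) ^ (k + 2) ∣
    40320 * PowerSeries.coeff (m * p ^ (k + 2)) (Fser p ^ 9) -
      (p * m * EU p (p ^ (k + 1)) +
        p ^ 2 * ∑ s ∈ range 8, w s * Uc p (p ^ (k + 1)) (s + 1)) := by
  have hp0 : p ≠ 0 := (Fact.out : p.Prime).ne_zero
  obtain ⟨V, hV⟩ := lift_formula (p := p) (p ^ (k + 1)) (pow_ne_zero _ hp0)
    (dvd_pow_self p (by omega))
  obtain ⟨z, hz⟩ := hV (p * m)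
  have hn : p * m = 0 ∨ 8 ≤ p * m := by
    rcases Nat.eq_zero_or_pos m with rfl | h
    · left; simp
    · right; nlinarith
  have hw : ∀ s, ∃ w : ℤ, s < 8 → 40320 * ((p * m + 7 - s).choose 8 : ℤ) =
      (p * m : ℕ) * (Ew s + (p * m : ℕ) * w) := by
    intro s
    by_cases hs : s < 8
    · obtain ⟨w, hw⟩ := choose_eight (p * m) s hn hs
      exact ⟨w, fun _ => hw⟩
    · exact ⟨0, fun h => absurd h hs⟩
  choose w hw using hw
  have hc : ∀ s, ∃ c : ℤ_[p], s < 8 → ((p * m + 7 - s).choose 9 : ℤ_[p]) = p * c := by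
    intro s
    by_cases hs : s < 8
    · obtain ⟨w, hw⟩ := dvd_choose_nine (p := p) hp10 m s hs
      exact ⟨w, fun _ => hw⟩
    · exact ⟨0, fun h => absurd h hs⟩
  choose c hc using hc
  refine ⟨fun s => m ^ 2 * (w s : ℤ_[p]), ?_⟩
  have e1 : m * p ^ (k + 2) = p * m * p ^ (k + 1) := by ring
  have h1 : 40320 * ∑ s ∈ range 8, Uc p (p ^ (k + 1)) (s + 1) *
      ((p * m + 7 - s).choose 8 : ℤ_[p]) = p * m * EU p (p ^ (k + 1)) +
        p ^ 2 * ∑ s ∈ range 8, (m ^ 2 * (w s : ℤ_[p])) * Uc p (p ^ (k + 1)) (s + 1) := by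
    simp only [EU, Finset.mul_sum]
    rw [← Finset.sum_add_distrib]
    refine Finset.sum_congr rfl fun s hs => ?_
    have := congrArg (fun x : ℤ => (x : ℤ_[p])) (hw s (mem_range.1 hs))
    push_cast at this
    linear_combination Uc p (p ^ (k + 1)) (s + 1) * this
  have h2 : ∑ s ∈ range 8, V (s + 1) * ((p * m + 7 - s).choose 9 : ℤ_[p]) =
      p * ∑ s ∈ range 8, V (s + 1) * c s := by
    rw [Finset.mul_sum]
    refine Finset.sum_congr rfl fun s hs => ?_
    rw [hc s (mem_range.1 hs)]; ring
  rw [e1, hz, h2]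
  refine ⟨-(40320 * 9 * ∑ s ∈ range 8, V (s + 1) * c s) + 40320 * p ^ k * z, ?_⟩
  push_cast
  linear_combination h1

lemma main_induct (hp10 : 10 < p) (k : ℕ) (hk : 1 ≤ k) : ∀ m : ℕ, (p : ℤ_[p]) ^ (k + 1) ∣
    40320 * PowerSeries.coeff (m * p ^ (k + 1)) (Fser p ^ 9) - m * p ^ k * EU p p := by
  have hp0 : p ≠ 0 := (Fact.out : p.Prime).ne_zero
  induction k, hk using Nat.le_induction with
  | base =>
    intro m
    obtain ⟨w, z, hw⟩ := lift_step (p := p) hp10 0 m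
    simp only [zero_add, pow_one] at hw
    refine ⟨∑ s ∈ range 8, w s * Uc p p (s + 1) + z, ?_⟩
    simp only [zero_add, pow_one, Nat.reduceAdd] at hw ⊢
    linear_combination hw
  | succ k hk ih =>
    obtain ⟨j, rfl⟩ : ∃ j, k = j + 1 := ⟨k - 1, by omega⟩
    intro m
    set q := p ^ (j + 1 + 1) with hq
    set E := EU p p
    have hU : ∀ i, i ≤ 8 → ∃ z : ℤ_[p], 40320 * ∑ s ∈ range 8, Uc p q (s + 1) *
        ((i + 7 - s).choose 8 : ℤ_[p]) = i * p ^ (j + 1) * E + p ^ (j + 2) * z := by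
      intro i _
      obtain ⟨V, hV⟩ := lift_formula (p := p) q (pow_ne_zero _ hp0) (dvd_pow_self p (by omega))
      obtain ⟨z, hz⟩ := hV i
      obtain ⟨y, hy⟩ := ih i
      rw [hz] at hy
      have hqq : (q : ℤ_[p]) = p ^ (j + 2) := by rw [hq]; push_cast; ring
      rw [hqq] at hy
      refine ⟨y + 40320 * 9 * ∑ s ∈ range 8, V (s + 1) * ((i + 7 - s).choose 9 : ℤ_[p])
        - 40320 * p ^ (j + 2) * z, ?_⟩
      linear_combination hy
    obtain ⟨z1, h1⟩ := hU 1 (by norm_num)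
    obtain ⟨z2, h2⟩ := hU 2 (by norm_num)
    obtain ⟨z3, h3⟩ := hU 3 (by norm_num)
    obtain ⟨z4, h4⟩ := hU 4 (by norm_num)
    obtain ⟨z5, h5⟩ := hU 5 (by norm_num)
    obtain ⟨z6, h6⟩ := hU 6 (by norm_num)
    obtain ⟨z7, h7⟩ := hU 7 (by norm_num)
    obtain ⟨z8, h8⟩ := hU 8 (by norm_num)
    clear hU
    norm_num [Finset.sum_range_succ, Nat.choose] at h1 h2 h3 h4 h5 h6 h7 h8
    obtain ⟨w, x, hw⟩ := lift_step (p := p) hp10 (j + 1) m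
    have hdU : ∀ s, ∃ y : ℤ_[p], s < 8 → Uc p q (s + 1) = p ^ (j + 1) * y := by
      intro s
      by_cases hs : s < 8
      · have : (p : ℤ_[p]) ^ (j + 1) ∣ Uc p q (s + 1) := by
          apply dvd_of_nat_mul (prime_not_dvd_factorial hp10 8 (by norm_num))
          rw [show ((Nat.factorial 8 : ℕ) : ℤ_[p]) = 40320 by norm_num [Nat.factorial]]
          interval_cases s
          · refine ⟨(1) * E + p * ((1) * z1), ?_⟩
            linear_combination (1) * h1
          · refine ⟨(-7) * E + p * ((1) * z2 + (-9) * z1), ?_⟩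
            linear_combination (1) * h2 + (-9) * h1
          · refine ⟨(21) * E + p * ((1) * z3 + (-9) * z2 + (36) * z1), ?_⟩
            linear_combination (1) * h3 + (-9) * h2 + (36) * h1
          · refine ⟨(-35) * E + p * ((1) * z4 + (-9) * z3 + (36) * z2 + (-84) * z1), ?_⟩
            linear_combination (1) * h4 + (-9) * h3 + (36) * h2 + (-84) * h1
          · refine ⟨(35) * E + p * ((1) * z5 + (-9) * z4 + (36) * z3 + (-84) * z2 + (126) * z1), ?_⟩
            linear_combination (1) * h5 + (-9) * h4 + (36) * h3 + (-84) * h2 + (126) * h1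
          · refine ⟨(-21) * E + p * ((1) * z6 + (-9) * z5 + (36) * z4 + (-84) * z3 + (126) * z2 + (-126) * z1), ?_⟩
            linear_combination (1) * h6 + (-9) * h5 + (36) * h4 + (-84) * h3 + (126) * h2 + (-126) * h1
          · refine ⟨(7) * E + p * ((1) * z7 + (-9) * z6 + (36) * z5 + (-84) * z4 + (126) * z3 + (-126) * z2 + (84) * z1), ?_⟩
            linear_combination (1) * h7 + (-9) * h6 + (36) * h5 + (-84) * h4 + (126) * h3 + (-126) * h2 + (84) * h1
          · refine ⟨(-1) * E + p * ((1) * z8 + (-9) * z7 + (36) * z6 + (-84) * z5 + (126) * z4 + (-126) * z3 + (84) * z2 + (-36) * z1), ?_⟩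
            linear_combination (1) * h8 + (-9) * h7 + (36) * h6 + (-84) * h5 + (126) * h4 + (-126) * h3 + (84) * h2 + (-36) * h1
        obtain ⟨y, hy⟩ := this
        exact ⟨y, fun _ => hy⟩
      · exact ⟨0, fun h => absurd h hs⟩
    choose y hy using hdU
    have hEU : (p : ℤ_[p]) ^ (j + 2) ∣ EU p q - p ^ (j + 1) * E := by
      apply dvd_of_nat_mul (prime_not_dvd_factorial hp10 8 (by norm_num))
      rw [show ((Nat.factorial 8 : ℕ) : ℤ_[p]) = 40320 by norm_num [Nat.factorial]]
      have hE : EU p q = 5040 * Uc p q 1 - 720 * Uc p q 2 + 240 * Uc p q 3 - 144 * Uc p q 4 + 144 * Uc p q 5 - 240 * Uc p q 6 + 720 * Uc p q 7 - 5040 * Uc p q 8 := by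
        simp [EU, Finset.sum_range_succ, Ew, Nat.factorial]
        ring
      rw [hE]
      refine ⟨(322560) * z1 + (-564480) * z2 + (752640) * z3 + (-705600) * z4 + (451584) * z5 + (-188160) * z6 + (46080) * z7 + (-5040) * z8, ?_⟩
      linear_combination (322560) * h1 + (-564480) * h2 + (752640) * h3 + (-705600) * h4 + (451584) * h5 + (-188160) * h6 + (46080) * h7 + (-5040) * h8
    obtain ⟨v, hv⟩ := hEU
    have hsum : ∑ s ∈ range 8, w s * Uc p q (s + 1) = p ^ (j + 1) * ∑ s ∈ range 8, w s * y s := by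
      rw [Finset.mul_sum]
      refine Finset.sum_congr rfl fun s hs => ?_
      rw [hy s (mem_range.1 hs)]; ring
    rw [← hq, hsum] at hw
    refine ⟨x + ∑ s ∈ range 8, w s * y s + m * v, ?_⟩
    linear_combination hw + p * m * hv

end induct

section powersums
variable {p : ℕ} [Fact p.Prime]

/-- The Bernoulli number as a p-adic integer (when it is integral). -/
noncomputable def bet (p : ℕ) [Fact p.Prime] (n : ℕ) : ℤ_[p] :=
  if h : ∃ x : ℤ_[p], (x : ℚ_[p]) = ((bernoulli n : ℚ) : ℚ_[p]) then h.choose else 0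

lemma bet_coe_of (n : ℕ) (x : ℤ_[p]) (h : (x : ℚ_[p]) = ((bernoulli n : ℚ) : ℚ_[p])) :
    (bet p n : ℚ_[p]) = ((bernoulli n : ℚ) : ℚ_[p]) := by
  have h1 : ∃ x : ℤ_[p], (x : ℚ_[p]) = ((bernoulli n : ℚ) : ℚ_[p]) := ⟨x, h⟩
  unfold bet
  rw [dif_pos h1]
  exact h1.choose_spec

lemma bet_coe (n : ℕ) (hn : n + 1 < p) :
    (bet p n : ℚ_[p]) = ((bernoulli n : ℚ) : ℚ_[p]) := by
  induction n using Nat.strong_induction_on with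
  | _ n ih =>
    have hs := sum_bernoulli (n + 1)
    rw [Finset.sum_range_succ] at hs
    have hnd : ¬ p ∣ (n + 1) := fun h => by
      have := Nat.le_of_dvd (by omega) h; omega
    apply bet_coe_of n
      (iv p (n + 1) * ((if n + 1 = 1 then 1 else 0) -
        ∑ k ∈ range n, ((n + 1).choose k : ℤ_[p]) * bet p k))
    have hne : ((n + 1 : ℕ) : ℚ_[p]) ≠ 0 := by
      exact_mod_cast Nat.succ_ne_zero n
    have hmi := congrArg (fun x : ℤ_[p] => (x : ℚ_[p])) (mul_iv hnd)
    have hs' := congrArg (fun x : ℚ => (x : ℚ_[p])) hs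
    simp only [Rat.cast_add, Rat.cast_mul, Rat.cast_sum, Rat.cast_natCast] at hs'
    have hsum : ((∑ k ∈ range n, ((n + 1).choose k : ℤ_[p]) * bet p k : ℤ_[p]) : ℚ_[p])
        = ∑ k ∈ range n, ((n + 1).choose k : ℚ_[p]) * ((bernoulli k : ℚ) : ℚ_[p]) := by
      rw [PadicInt.coe_sum]
      refine Finset.sum_congr rfl fun k hk => ?_
      have := List.mem_range.1 (by simpa using hk)
      rw [PadicInt.coe_mul, ih k this (by omega), PadicInt.coe_natCast]
    have hif : (((if n + 1 = 1 then 1 else 0 : ℤ_[p])) : ℚ_[p])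
        = ((if n + 1 = 1 then 1 else 0 : ℚ) : ℚ_[p]) := by
      split_ifs <;> simp
    rw [PadicInt.coe_mul, PadicInt.coe_sub, hsum, hif]
    have hc : ((n + 1).choose n) = n + 1 := by simp
    rw [hc] at hs'
    simp only [PadicInt.coe_mul, PadicInt.coe_natCast, PadicInt.coe_one] at hmi
    rw [← hs']
    linear_combination (((bernoulli n : ℚ) : ℚ_[p])) * hmi

/-- Power sums over residues. -/
noncomputable def Tn (p : ℕ) [Fact p.Prime] (n : ℕ) : ℤ_[p] := ∑ a ∈ range p, (a : ℤ_[p]) ^ n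

/-- Inverse power sums over residues. -/
noncomputable def Hn (p : ℕ) [Fact p.Prime] (n : ℕ) : ℤ_[p] := ∑ a ∈ range p, iv p a ^ n

lemma Tn_bernoulli (n : ℕ) (hn : n + 1 < p) :
    (p : ℤ_[p]) ^ 2 ∣ Tn p n - p * bet p n := by
  have hnd : ¬ p ∣ (n + 1) := fun h => by
    have := Nat.le_of_dvd (by omega) h; omega
  have key : ((n + 1 : ℕ) : ℤ_[p]) * Tn p n =
      ∑ i ∈ range (n + 1), bet p i * ((n + 1).choose i : ℤ_[p]) * (p : ℤ_[p]) ^ (n + 1 - i) := by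
    apply PadicInt.ext
    have hs := congrArg (fun x : ℚ => (x : ℚ_[p])) (sum_range_pow p n)
    simp only [Rat.cast_sum, Rat.cast_pow, Rat.cast_natCast, Rat.cast_div, Rat.cast_mul,
      Rat.cast_add, Rat.cast_one] at hs
    have hne : ((n : ℚ_[p]) + 1) ≠ 0 := by
      exact_mod_cast Nat.succ_ne_zero n
    rw [← Finset.sum_div, eq_div_iff hne] at hs
    unfold Tn
    rw [PadicInt.coe_mul, PadicInt.coe_sum, PadicInt.coe_sum]
    simp only [PadicInt.coe_mul, PadicInt.coe_pow, PadicInt.coe_natCast]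
    push_cast
    rw [mul_comm, hs]
    refine Finset.sum_congr rfl fun k hk => ?_
    have := Finset.mem_range.1 hk
    rw [bet_coe k (by omega)]
  apply dvd_of_nat_mul hnd
  rw [Finset.sum_range_succ] at key
  have hc : ((n + 1).choose n) = n + 1 := by simp
  rw [hc, Nat.add_sub_cancel_left] at key
  have : ((n + 1 : ℕ) : ℤ_[p]) * (Tn p n - p * bet p n) =
    ∑ i ∈ range n, bet p i * ((n + 1).choose i : ℤ_[p]) * (p : ℤ_[p]) ^ (n + 1 - i) := by
    linear_combination key
  rw [this]
  refine Finset.dvd_sum fun i hi => ?_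
  have := Finset.mem_range.1 hi
  exact Dvd.dvd.mul_left (pow_dvd_pow _ (by omega)) _

lemma sum_perm (g : ℕ) (hg : ¬ p ∣ g) (F : ℕ → ℤ_[p]) :
    ∑ a ∈ range p, F (g * a % p) = ∑ a ∈ range p, F a := by
  have hpp : p.Prime := Fact.out
  have hinj : Set.InjOn (fun a => g * a % p) (range p) := by
    intro a ha b hb hab
    have ha' := Finset.mem_range.1 (Finset.mem_coe.1 ha)
    have hb' := Finset.mem_range.1 (Finset.mem_coe.1 hb)
    have h1 : g * a ≡ g * b [MOD p] := hab
    have h2 : a ≡ b [MOD p] := Nat.ModEq.cancel_left_of_coprime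
      ((Nat.Prime.coprime_iff_not_dvd hpp).2 hg) h1
    have := h2
    unfold Nat.ModEq at this
    rwa [Nat.mod_eq_of_lt ha', Nat.mod_eq_of_lt hb'] at this
  have him : (range p).image (fun a => g * a % p) = range p := by
    apply Finset.eq_of_subset_of_card_le
    · intro x hx
      obtain ⟨a, _, rfl⟩ := Finset.mem_image.1 hx
      exact Finset.mem_range.2 (Nat.mod_lt _ hpp.pos)
    · rw [Finset.card_image_of_injOn hinj]
  conv_rhs => rw [← him, Finset.sum_image hinj]

lemma exists_gen : ∃ g : ℕ, ¬ p ∣ g ∧ ∀ k, 0 < k → k < p - 1 →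
    IsUnit (iv p g ^ k - 1) ∧ IsUnit ((g : ℤ_[p]) ^ k - 1) := by
  have hpp : p.Prime := Fact.out
  obtain ⟨u, hu⟩ := IsCyclic.exists_ofOrder_eq_natCard (α := (ZMod p)ˣ)
  rw [Nat.card_eq_fintype_card, ZMod.card_units] at hu
  have hg0 : ¬ p ∣ (u : ZMod p).val := by
    rw [← ZMod.natCast_eq_zero_iff]
    simp
  refine ⟨(u : ZMod p).val, hg0, fun k hk hk' => ?_⟩
  have hne : (u : ZMod p) ^ k ≠ 1 := by
    intro h
    have h1 : u ^ k = 1 := by ext; simpa using h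
    have := orderOf_dvd_of_pow_eq_one h1
    rw [hu] at this
    have := Nat.le_of_dvd hk this
    omega
  have h2 : IsUnit ((((u : ZMod p).val : ℕ) : ℤ_[p]) ^ k - 1) := by
    by_contra hcon
    have h3 : (((u : ZMod p).val : ℕ) : ℤ_[p]) ^ k - 1 ∈ IsLocalRing.maximalIdeal ℤ_[p] :=
      (IsLocalRing.mem_maximalIdeal _).2 hcon
    rw [← PadicInt.ker_toZMod, RingHom.mem_ker] at h3
    simp [sub_eq_zero] at h3
    exact hne h3
  refine ⟨?_, h2⟩
  have h4 := mul_iv hg0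
  set G := (((u : ZMod p).val : ℕ) : ℤ_[p])
  set v := iv p (u : ZMod p).val
  have h5 : G ^ k * (v ^ k - 1) = - (G ^ k - 1) := by
    have : G ^ k * v ^ k = 1 := by rw [← mul_pow, h4, one_pow]
    linear_combination this
  exact isUnit_of_mul_isUnit_right (h5 ▸ h2.neg)

lemma iv_mul (a b : ℕ) : iv p (a * b) = iv p a * iv p b := by
  have hpp : p.Prime := Fact.out
  by_cases ha : p ∣ a
  · rw [iv_of_dvd ha, iv_of_dvd (Dvd.dvd.mul_right ha b), zero_mul]
  by_cases hb : p ∣ b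
  · rw [iv_of_dvd hb, iv_of_dvd (Dvd.dvd.mul_left hb a), mul_zero]
  have hab : ¬ p ∣ a * b := by rw [hpp.dvd_mul]; tauto
  have h1 := mul_iv ha
  have h2 := mul_iv hb
  have h3 := mul_iv hab
  push_cast at h3
  linear_combination (-iv p (a*b) * b * iv p b) * h1 - iv p (a * b) * h2 + iv p a * iv p b * h3

lemma add_pow_two_dvd (n : ℕ) (P x y : ℤ_[p]) :
    P ^ 2 ∣ (x + P * y) ^ (n + 1) - x ^ (n + 1) - (n + 1 : ℕ) * P * y * x ^ n := by
  induction n with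
  | zero => simp
  | succ n ih =>
    obtain ⟨c, hc⟩ := ih
    refine ⟨c * (x + P * y) + (n + 1 : ℕ) * y ^ 2 * x ^ n, ?_⟩
    push_cast at hc ⊢
    rw [pow_succ (x + P * y) (n + 1)]
    linear_combination (x + P * y) * hc

/-- The weighted quotient sum. -/
lemma gtrick_H (g k : ℕ) (hg : ¬ p ∣ g) :
    (p : ℤ_[p]) ^ 2 ∣ (iv p g ^ (k + 1) - 1) * Hn p (k + 1) +
      (k + 1 : ℕ) * p * ∑ a ∈ range p, ((g * a / p : ℕ) : ℤ_[p]) * iv p (g * a % p) ^ (k + 2) := by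
  have h1 : Hn p (k + 1) = ∑ a ∈ range p, iv p (g * a % p) ^ (k + 1) :=
    (sum_perm g hg (fun a => iv p a ^ (k + 1))).symm
  have h2 : (iv p g ^ (k + 1) - 1) * Hn p (k + 1) +
      (k + 1 : ℕ) * p * ∑ a ∈ range p, ((g * a / p : ℕ) : ℤ_[p]) * iv p (g * a % p) ^ (k + 2)
      = ∑ a ∈ range p, (iv p (g * a) ^ (k + 1) - iv p (g * a % p) ^ (k + 1) +
        (k + 1 : ℕ) * p * (((g * a / p : ℕ) : ℤ_[p]) * iv p (g * a % p) ^ (k + 2))) := by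
    rw [Finset.sum_add_distrib, Finset.sum_sub_distrib, ← h1, sub_mul, one_mul, ← Finset.mul_sum]
    congr 2
    unfold Hn
    rw [Finset.mul_sum]
    refine Finset.sum_congr rfl fun a _ => ?_
    rw [iv_mul, mul_pow]
  rw [h2]
  refine Finset.dvd_sum fun a _ => ?_
  obtain ⟨z, hz⟩ := iv_congr (dvd_refl p) (g * a % p) (g * a / p)
  rw [Nat.mod_add_div] at hz
  set u := iv p (g * a % p)
  set q : ℤ_[p] := ((g * a / p : ℕ) : ℤ_[p])
  obtain ⟨c, hc⟩ := add_pow_two_dvd (p := p) k (p : ℤ_[p]) u (-(q * u ^ 2) + p * z)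
  have e : iv p (g * a) = u + p * (-(q * u ^ 2) + p * z) := by rw [hz]; ring
  rw [e]
  refine ⟨c + (k + 1 : ℕ) * z * u ^ k, ?_⟩
  linear_combination hc

lemma gtrick_T (g n : ℕ) (hg : ¬ p ∣ g) :
    (p : ℤ_[p]) ^ 2 ∣ ((g : ℤ_[p]) ^ (n + 1) - 1) * Tn p (n + 1) -
      (n + 1 : ℕ) * p * ∑ a ∈ range p, ((g * a / p : ℕ) : ℤ_[p]) * ((g * a % p : ℕ) : ℤ_[p]) ^ n := by
  have h1 : Tn p (n + 1) = ∑ a ∈ range p, ((g * a % p : ℕ) : ℤ_[p]) ^ (n + 1) :=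
    (sum_perm g hg (fun a => (a : ℤ_[p]) ^ (n + 1))).symm
  have h2 : ((g : ℤ_[p]) ^ (n + 1) - 1) * Tn p (n + 1) -
      (n + 1 : ℕ) * p * ∑ a ∈ range p, ((g * a / p : ℕ) : ℤ_[p]) * ((g * a % p : ℕ) : ℤ_[p]) ^ n
      = ∑ a ∈ range p, (((g * a : ℕ) : ℤ_[p]) ^ (n + 1) - ((g * a % p : ℕ) : ℤ_[p]) ^ (n + 1) -
        (n + 1 : ℕ) * p * (((g * a / p : ℕ) : ℤ_[p]) * ((g * a % p : ℕ) : ℤ_[p]) ^ n)) := by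
    rw [Finset.sum_sub_distrib, Finset.sum_sub_distrib, ← h1, sub_mul, one_mul, ← Finset.mul_sum]
    congr 2
    unfold Tn
    rw [Finset.mul_sum]
    refine Finset.sum_congr rfl fun a _ => ?_
    push_cast
    rw [mul_pow]
  rw [h2]
  refine Finset.dvd_sum fun a _ => ?_
  have hz : ((g * a : ℕ) : ℤ_[p]) = ((g * a % p : ℕ) : ℤ_[p]) + p * ((g * a / p : ℕ) : ℤ_[p]) := by
    have := Nat.mod_add_div (g * a) p
    exact_mod_cast this.symm
  rw [hz]
  obtain ⟨c, hc⟩ := add_pow_two_dvd (p := p) n (p : ℤ_[p]) ((g * a % p : ℕ) : ℤ_[p])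
    ((g * a / p : ℕ) : ℤ_[p])
  exact ⟨c, by linear_combination hc⟩

lemma unit_dvd {u x a : ℤ_[p]} (hu : IsUnit u) (h : a ∣ u * x) : a ∣ x := by
  rwa [IsUnit.dvd_mul_left hu] at h

lemma Hn_dvd (k : ℕ) (hk : 0 < k) (hk' : k < p - 1) : (p : ℤ_[p]) ∣ Hn p k := by
  obtain ⟨g, hg, hgk⟩ := exists_gen (p := p)
  obtain ⟨k, rfl⟩ : ∃ j, k = j + 1 := ⟨k - 1, by omega⟩
  apply unit_dvd (hgk _ hk hk').1
  obtain ⟨c, hc⟩ := gtrick_H (p := p) g k hg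
  rw [← eq_sub_iff_add_eq] at hc
  rw [hc]
  exact ⟨p * c - (k + 1 : ℕ) * ∑ a ∈ range p, ((g * a / p : ℕ) : ℤ_[p]) * iv p (g * a % p) ^ (k + 2), by ring⟩

lemma fermat_iv (a m n : ℕ) (ha : ¬ p ∣ a) (h : m + n = p - 1) :
    (p : ℤ_[p]) ∣ (a : ℤ_[p]) ^ m - iv p a ^ n := by
  have h1 : (p : ℤ_[p]) ∣ (a : ℤ_[p]) ^ (p - 1) - 1 := by
    have : (a : ℤ_[p]) ^ (p - 1) - 1 ∈ IsLocalRing.maximalIdeal ℤ_[p] := by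
      rw [← PadicInt.ker_toZMod, RingHom.mem_ker]
      simp only [map_sub, map_pow, map_natCast, map_one]
      rw [ZMod.pow_card_sub_one_eq_one, sub_self]
      rwa [Ne, ZMod.natCast_eq_zero_iff]
    rw [PadicInt.maximalIdeal_eq_span_p] at this
    exact Ideal.mem_span_singleton.1 this
  have h2 : (a : ℤ_[p]) ^ m - iv p a ^ n = ((a : ℤ_[p]) ^ (p - 1) - 1) * iv p a ^ n := by
    have : (a : ℤ_[p]) ^ n * iv p a ^ n = 1 := by rw [← mul_pow, mul_iv ha, one_pow]
    rw [← h, pow_add]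
    linear_combination (-(a:ℤ_[p])^m) * this
  rw [h2]
  exact Dvd.dvd.mul_right h1 _

lemma Hn_Tn (k : ℕ) (hk : 0 < k) (hk' : k + 1 < p - 1) :
    (p : ℤ_[p]) ^ 2 ∣ (k + 1 : ℕ) * Hn p k - k * Tn p (p - 1 - k) := by
  obtain ⟨g, hg, hgk⟩ := exists_gen (p := p)
  have hpp : p.Prime := Fact.out
  have hp0 : (p : ℤ_[p]) ≠ 0 := by exact_mod_cast hpp.ne_zero
  apply unit_dvd (hgk k hk (by omega)).1
  obtain ⟨n, hn⟩ : ∃ n, p - 1 - k = n + 1 := ⟨p - 1 - k - 1, by omega⟩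
  rw [hn]
  obtain ⟨k, rfl⟩ : ∃ j, k = j + 1 := ⟨k - 1, by omega⟩
  obtain ⟨c1, h1⟩ := gtrick_H (p := p) g k hg
  obtain ⟨c2, h2⟩ := gtrick_T (p := p) g n hg
  have hT : (p : ℤ_[p]) ∣ Tn p (n + 1) := by
    apply unit_dvd (hgk (n + 1) (by omega) (by omega)).2
    rw [sub_eq_iff_eq_add] at h2
    rw [h2]
    exact ⟨p * c2 + (n + 1 : ℕ) * ∑ a ∈ range p, ((g * a / p : ℕ) : ℤ_[p]) * ((g * a % p : ℕ) : ℤ_[p]) ^ n, by ring⟩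
  obtain ⟨t, ht⟩ := hT
  obtain ⟨d, hd⟩ := fermat_iv (p := p) g (n + 1) (k + 1) hg (by omega)
  have hQ : (p : ℤ_[p]) ∣ ∑ a ∈ range p, ((g * a / p : ℕ) : ℤ_[p]) * ((g * a % p : ℕ) : ℤ_[p]) ^ n -
      ∑ a ∈ range p, ((g * a / p : ℕ) : ℤ_[p]) * iv p (g * a % p) ^ (k + 2) := by
    rw [← Finset.sum_sub_distrib]
    refine Finset.dvd_sum fun a ha => ?_
    have ha' := Finset.mem_range.1 ha
    rw [← mul_sub]
    by_cases h0 : a = 0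
    · subst h0; simp
    apply Dvd.dvd.mul_left
    apply fermat_iv _ _ _ _ (by omega)
    rw [Nat.dvd_mod_iff (dvd_refl p), hpp.dvd_mul]
    rintro (h | h)
    · exact hg h
    · have := Nat.le_of_dvd (by omega) h; omega
  obtain ⟨e, he⟩ := hQ
  set Q := ∑ a ∈ range p, ((g * a / p : ℕ) : ℤ_[p]) * iv p (g * a % p) ^ (k + 2)
  set Q' := ∑ a ∈ range p, ((g * a / p : ℕ) : ℤ_[p]) * ((g * a % p : ℕ) : ℤ_[p]) ^ n
  have hnk : ((n + 1 : ℕ) : ℤ_[p]) = p - (k + 2 : ℕ) := by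
    have : n + 1 + (k + 2) = p := by omega
    rw [eq_sub_iff_add_eq]; exact_mod_cast this
  rw [hnk] at h2
  rw [ht] at h2 ⊢
  push_cast at *
  refine ⟨(k+2) * c1 - (k+1) * c2 + (k+1) * d * t - (k + 1) * (Q' - (k + 2) * e), ?_⟩
  linear_combination (k+2 : ℤ_[p]) * h1 - (k+1:ℤ_[p]) * h2 + (k+1:ℤ_[p]) * p * t * hd + (k+1:ℤ_[p])*(k+2)*p * he

/-- Symmetric pair products. -/
noncomputable def cpair (p : ℕ) [Fact p.Prime] (a : ℕ) : ℤ_[p] := iv p a * iv p (p - a)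

lemma cpair_eq (a : ℕ) (ha : a < p) :
    ∃ z, cpair p a = -(iv p a ^ 2 + p * iv p a ^ 3) + (p : ℤ_[p]) ^ 2 * z := by
  unfold cpair
  by_cases h0 : a = 0
  · subst h0
    exact ⟨0, by rw [iv_zero]; ring⟩
  have h1 : ¬ p ∣ a := fun h => by have := Nat.le_of_dvd (by omega) h; omega
  have h2 : ¬ p ∣ p - a := fun h => by have := Nat.le_of_dvd (by omega) h; omega
  have e1 := mul_iv h1
  have e2 := mul_iv h2
  rw [Nat.cast_sub ha.le] at e2
  set u := iv p a
  set v := iv p (p - a)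
  have e3 : u + v = p * u * v := by linear_combination (-v) * e1 - u * e2
  exact ⟨u ^ 3 * v, by linear_combination (u + p * u ^ 2) * e3⟩

/-- Power sums of the pair products. -/
noncomputable def Ps (p : ℕ) [Fact p.Prime] (i : ℕ) : ℤ_[p] := ∑ a ∈ range p, cpair p a ^ i

lemma Ps_one : ∃ z, Ps p 1 = -Hn p 2 - p * Hn p 3 + (p : ℤ_[p]) ^ 2 * z := by
  have h : (p : ℤ_[p]) ^ 2 ∣ Ps p 1 - (-Hn p 2 - p * Hn p 3) := by
    unfold Ps Hn
    rw [Finset.mul_sum, ← Finset.sum_neg_distrib, ← Finset.sum_sub_distrib, ← Finset.sum_sub_distrib]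
    refine Finset.dvd_sum fun a ha => ?_
    obtain ⟨z, hz⟩ := cpair_eq a (Finset.mem_range.1 ha)
    exact ⟨z, by rw [hz]; ring⟩
  obtain ⟨z, hz⟩ := h
  exact ⟨z, by linear_combination hz⟩

lemma Ps_four : ∃ z, Ps p 4 = Hn p 8 + 4 * p * Hn p 9 + (p : ℤ_[p]) ^ 2 * z := by
  have h : (p : ℤ_[p]) ^ 2 ∣ Ps p 4 - (Hn p 8 + 4 * p * Hn p 9) := by
    unfold Ps Hn
    rw [Finset.mul_sum, ← Finset.sum_add_distrib, ← Finset.sum_sub_distrib]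
    refine Finset.dvd_sum fun a ha => ?_
    obtain ⟨z, hz⟩ := cpair_eq a (Finset.mem_range.1 ha)
    rw [hz]
    set u := iv p a
    set P : ℤ_[p] := (p : ℤ_[p])
    obtain ⟨c, hc⟩ := add_pow_two_dvd (p := p) 3 P (-u ^ 2) (-u ^ 3 + P * z)
    have : -(u ^ 2 + P * u ^ 3) + P ^ 2 * z = -u ^ 2 + P * (-u ^ 3 + P * z) := by ring
    rw [this]
    refine ⟨c - 4 * u ^ 6 * z, ?_⟩
    push_cast at hc
    linear_combination hc
  obtain ⟨z, hz⟩ := h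
  exact ⟨z, by linear_combination hz⟩

lemma Ps_dvd (i : ℕ) (hi : 0 < i) (hi' : 2 * i < p - 1) : (p : ℤ_[p]) ∣ Ps p i := by
  have h : (p : ℤ_[p]) ∣ Ps p i - (-1) ^ i * Hn p (2 * i) := by
    unfold Ps Hn
    rw [Finset.mul_sum, ← Finset.sum_sub_distrib]
    refine Finset.dvd_sum fun a ha => ?_
    obtain ⟨z, hz⟩ := cpair_eq a (Finset.mem_range.1 ha)
    have : (-1) ^ i * iv p a ^ (2 * i) = (-iv p a ^ 2) ^ i := by
      rw [pow_mul, ← mul_pow]; ring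
    rw [this]
    refine dvd_trans ?_ (sub_dvd_pow_sub_pow _ _ i)
    rw [hz]
    exact ⟨-iv p a ^ 3 + p * z, by ring⟩
  have h2 := Hn_dvd (p := p) (2 * i) (by omega) hi'
  have := dvd_add h (Dvd.dvd.mul_left h2 ((-1) ^ i))
  simpa using this

lemma Ps_main (hp10 : 10 < p) : ∃ ρ1 ρ2 ρ3 ρ4 : ℤ_[p],
    Ps p 1 = p * ρ1 ∧ Ps p 2 = p * ρ2 ∧ Ps p 3 = p * ρ3 ∧ Ps p 4 = p * ρ4 ∧
    (p : ℤ_[p]) ∣ 3 * ρ1 + 2 * bet p (p - 3) ∧ (p : ℤ_[p]) ∣ 9 * ρ4 - 8 * bet p (p - 9) := by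
  have hpp : p.Prime := Fact.out
  have hp0 : (p : ℤ_[p]) ≠ 0 := by exact_mod_cast hpp.ne_zero
  obtain ⟨ρ1, h1⟩ := Ps_dvd (p := p) 1 (by omega) (by omega)
  obtain ⟨ρ2, h2⟩ := Ps_dvd (p := p) 2 (by omega) (by omega)
  obtain ⟨ρ3, h3⟩ := Ps_dvd (p := p) 3 (by omega) (by omega)
  obtain ⟨ρ4, h4⟩ := Ps_dvd (p := p) 4 (by omega) (by omega)
  refine ⟨ρ1, ρ2, ρ3, ρ4, h1, h2, h3, h4, ?_, ?_⟩
  · obtain ⟨z, hz⟩ := Ps_one (p := p)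
    obtain ⟨y, hy⟩ := Hn_dvd (p := p) 3 (by omega) (by omega)
    obtain ⟨x, hx⟩ := Hn_Tn (p := p) 2 (by omega) (by omega)
    rw [show p - 1 - 2 = p - 3 by omega] at hx
    obtain ⟨w, hw⟩ := Tn_bernoulli (p := p) (p - 3) (by omega)
    rw [h1] at hz
    refine ⟨3 * z - 3 * y - x - 2 * w, ?_⟩
    apply mul_left_cancel₀ hp0
    push_cast at hx
    linear_combination 3 * hz - 3 * p * hy - hx - 2 * hw
  · obtain ⟨z, hz⟩ := Ps_four (p := p)
    obtain ⟨y, hy⟩ := Hn_dvd (p := p) 9 (by omega) (by omega)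
    obtain ⟨x, hx⟩ := Hn_Tn (p := p) 8 (by omega) (by omega)
    rw [show p - 1 - 8 = p - 9 by omega] at hx
    obtain ⟨w, hw⟩ := Tn_bernoulli (p := p) (p - 9) (by omega)
    rw [h4] at hz
    refine ⟨9 * z + 36 * y + x + 8 * w, ?_⟩
    apply mul_left_cancel₀ hp0
    push_cast at hx
    linear_combination 9 * hz + 36 * p * hy + hx + 8 * hw

end powersums

section expo
variable {p : ℕ} [Fact p.Prime]

/-- Truncated exponential, with v an inverse of 24. -/
def e4 {R : Type*} [CommRing R] (v x : R) : R := 1 + x + 12 * v * x ^ 2 + 4 * v * x ^ 3 + v * x ^ 4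

/-- Truncated logarithm of one plus x, with v an inverse of 24. -/
def l4 {R : Type*} [CommRing R] (v x : R) : R := x - 12 * v * x ^ 2 + 8 * v * x ^ 3 - 6 * v * x ^ 4

lemma e4_mul {R : Type*} [CommRing R] (v P a b : R) (hv : 24 * v = 1) :
    P ^ 10 ∣ e4 v (P ^ 2 * a) * e4 v (P ^ 2 * b) - e4 v (P ^ 2 * a + P ^ 2 * b) := by
  refine ⟨v * a * b ^ 4 + v * a ^ 4 * b + 48 * v ^ 2 * a ^ 2 * b ^ 3 + 48 * v ^ 2 * a ^ 3 * b ^ 2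
    + P ^ 2 * (12 * v ^ 2 * a ^ 2 * b ^ 4 + 12 * v ^ 2 * a ^ 4 * b ^ 2 + 16 * v ^ 2 * a ^ 3 * b ^ 3)
    + P ^ 4 * (4 * v ^ 2 * a ^ 3 * b ^ 4 + 4 * v ^ 2 * a ^ 4 * b ^ 3) + P ^ 6 * v ^ 2 * a ^ 4 * b ^ 4, ?_⟩
  unfold e4
  linear_combination (6 * v * (P ^ 2 * a) ^ 2 * (P ^ 2 * b) ^ 2 - (P ^ 2 * a) * (P ^ 2 * b)) * hv

lemma e4_l4_aux {R : Type*} [CommRing R] (v x : R) (hv : 24 * v = 1) :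
    x ^ 5 ∣ e4 v (l4 v x) - (1 + x) := by
  refine ⟨(-96)*v^2*x^0 + (-576)*v^3*x^0 + (-40)*v^2*x^1 + (1056)*v^3*x^1 + (-6912)*v^4*x^1 + (-24)*v^2*x^2 + (192)*v^3*x^2 + (6912)*v^4*x^2 + (528)*v^3*x^3 + (-5760)*v^4*x^3 + (20736)*v^5*x^3 + (-144)*v^3*x^4 + (-3712)*v^4*x^4 + (-55296)*v^5*x^4 + (216)*v^3*x^5 + (6080)*v^4*x^5 + (96768)*v^5*x^5 + (-6336)*v^4*x^6 + (-107520)*v^5*x^6 + (2592)*v^4*x^7 + (90496)*v^5*x^7 + (-864)*v^4*x^8 + (-53760)*v^5*x^8 + (24192)*v^5*x^9 + (-6912)*v^5*x^10 + (1296)*v^5*x^11, ?_⟩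
  unfold e4 l4
  linear_combination (-12 * v * x ^ 3 + 5 * v * x ^ 4 + 72 * v ^ 2 * x ^ 4) * hv

lemma e4_l4 {R : Type*} [CommRing R] (v P x : R) (hv : 24 * v = 1) :
    P ^ 10 ∣ e4 v (l4 v (P ^ 2 * x)) - (1 + P ^ 2 * x) := by
  refine dvd_trans ?_ (e4_l4_aux v (P ^ 2 * x) hv)
  exact ⟨x ^ 5, by ring⟩

lemma e4_expand {R : Type*} [CommRing R] (v P x1 x2 x3 x4 : R) :
    P ^ 10 ∣ e4 v (P ^ 3 * x1 + P ^ 5 * x2 + P ^ 7 * x3 + P ^ 9 * x4) -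
      (1 + P ^ 3 * x1 + P ^ 5 * x2 + P ^ 7 * x3 + P ^ 9 * x4 +
        12 * v * (P ^ 6 * x1 ^ 2 + 2 * P ^ 8 * x1 * x2) + 4 * v * P ^ 9 * x1 ^ 3) := by
  obtain ⟨z, hz⟩ : ∃ z, z = x3 + P ^ 2 * x4 := ⟨_, rfl⟩
  obtain ⟨y, hy⟩ : ∃ y, y = x2 + P ^ 2 * z := ⟨_, rfl⟩
  refine ⟨12 * v * (x2 ^ 2 + 2 * x1 * z + 2 * P ^ 2 * x2 * z + P ^ 4 * z ^ 2)
    + 4 * v * P * y * (3 * x1 ^ 2 + 3 * x1 * P ^ 2 * y + P ^ 4 * y ^ 2)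
    + v * P ^ 2 * (x1 + P ^ 2 * y) ^ 4, ?_⟩
  subst hy hz
  unfold e4
  ring

/-- Product of one plus multiples of p. -/
noncomputable def Phi (p : ℕ) [Fact p.Prime] (c : ℕ) : ℤ_[p] :=
  ∏ a ∈ range p, (1 + p * c * iv p a)

lemma Phi_reflect (c : ℕ) : Phi p c = ∏ a ∈ range p, (1 + p * c * iv p (p - a)) := by
  have h := Finset.prod_range_reflect (fun a => 1 + (p : ℤ_[p]) * c * iv p a) (p + 1)
  rw [Finset.prod_range_succ, Finset.prod_range_succ] at h
  simp only [Nat.add_sub_cancel, Nat.sub_self] at h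
  rw [iv_zero, iv_of_dvd (dvd_refl p)] at h
  simp only [mul_zero, add_zero, mul_one] at h
  exact h.symm

lemma iv_add_reflect (a : ℕ) (ha : a < p) : iv p a + iv p (p - a) = p * (iv p a * iv p (p - a)) := by
  by_cases h0 : a = 0
  · subst h0
    rw [iv_zero, Nat.sub_zero, iv_of_dvd (dvd_refl p)]; ring
  have h1 : ¬ p ∣ a := fun h => by have := Nat.le_of_dvd (by omega) h; omega
  have h2 : ¬ p ∣ p - a := fun h => by have := Nat.le_of_dvd (by omega) h; omega
  have e1 := mul_iv h1
  have e2 := mul_iv h2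
  rw [Nat.cast_sub ha.le] at e2
  linear_combination (-iv p (p - a)) * e1 - iv p a * e2

lemma Phi_sq (c : ℕ) :
    Phi p c ^ 2 = ∏ a ∈ range p, (1 + (p : ℤ_[p]) ^ 2 * ((c * (c + 1) : ℕ) * cpair p a)) := by
  rw [sq]
  nth_rewrite 2 [Phi_reflect]
  unfold Phi
  rw [← Finset.prod_mul_distrib]
  refine Finset.prod_congr rfl fun a ha => ?_
  have h := iv_add_reflect a (Finset.mem_range.1 ha)
  unfold cpair
  push_cast
  linear_combination p * c * h

lemma prod_e4 {R : Type*} [CommRing R] (v P : R) (hv : 24 * v = 1) (x : ℕ → R) (n : ℕ) :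
    P ^ 10 ∣ ∏ a ∈ range n, (1 + P ^ 2 * x a) - e4 v (∑ a ∈ range n, l4 v (P ^ 2 * x a)) := by
  induction n with
  | zero => simp [e4]
  | succ n ih =>
    rw [Finset.prod_range_succ, Finset.sum_range_succ]
    have hl : ∀ y, l4 v (P ^ 2 * y) =
      P ^ 2 * (y - 12 * v * P ^ 2 * y ^ 2 + 8 * v * P ^ 4 * y ^ 3 - 6 * v * P ^ 6 * y ^ 4) := by
      intro y; unfold l4; ring
    obtain ⟨c1, h1⟩ := ih
    obtain ⟨c2, h2⟩ := e4_l4 v P (x n) hv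
    obtain ⟨c3, h3⟩ := e4_mul v P (∑ a ∈ range n, (x a - 12 * v * P ^ 2 * x a ^ 2 + 8 * v * P ^ 4 * x a ^ 3 - 6 * v * P ^ 6 * x a ^ 4))
      (x n - 12 * v * P ^ 2 * x n ^ 2 + 8 * v * P ^ 4 * x n ^ 3 - 6 * v * P ^ 6 * x n ^ 4) hv
    rw [Finset.mul_sum, ← hl, Finset.sum_congr rfl (fun a _ => (hl (x a)).symm)] at h3
    set A := ∏ a ∈ range n, (1 + P ^ 2 * x a)
    set S := ∑ a ∈ range n, l4 v (P ^ 2 * x a)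
    refine ⟨c1 * (1 + P ^ 2 * x n) - e4 v S * c2 + c3, ?_⟩
    linear_combination (1 + P ^ 2 * x n) * h1 - e4 v S * h2 + h3

/-- The log of the product, given the normalised power sums. -/
noncomputable def Lg (p : ℕ) [Fact p.Prime] (v r1 r2 r3 r4 : ℤ_[p]) (w : ℤ_[p]) : ℤ_[p] :=
  (p : ℤ_[p]) ^ 3 * (12 * v * r1 * w) + (p : ℤ_[p]) ^ 5 * (-6 * v * r2 * w ^ 2)
    + (p : ℤ_[p]) ^ 7 * (4 * v * r3 * w ^ 3) + (p : ℤ_[p]) ^ 9 * (-3 * v * r4 * w ^ 4)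

lemma Phi_one_mod (c : ℕ) : (p : ℤ_[p]) ∣ Phi p c - 1 := by
  unfold Phi
  have : ∀ n, (p : ℤ_[p]) ∣ ∏ a ∈ range n, (1 + p * c * iv p a) - 1 := by
    intro n
    induction n with
    | zero => simp
    | succ n ih =>
      obtain ⟨d, hd⟩ := ih
      rw [Finset.prod_range_succ, sub_eq_iff_eq_add.1 hd]
      exact ⟨d * (1 + p * c * iv p n) + c * iv p n, by ring⟩
  exact this p

lemma isUnit_of_two (hp10 : 10 < p) (x : ℤ_[p]) (h : (p : ℤ_[p]) ∣ x - 2) : IsUnit x := by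
  by_contra hx
  have h1 : x ∈ IsLocalRing.maximalIdeal ℤ_[p] := (IsLocalRing.mem_maximalIdeal _).2 hx
  rw [PadicInt.maximalIdeal_eq_span_p] at h1
  have h2 := dvd_sub (Ideal.mem_span_singleton.1 h1) h
  rw [sub_sub_cancel] at h2
  have h3 : IsUnit ((2 : ℕ) : ℤ_[p]) := (isUnit_nat_iff 2).2 (fun h => by
    have := Nat.le_of_dvd (by omega) h; omega)
  have h4 : IsUnit (p : ℤ_[p]) := isUnit_of_dvd_unit h2 (by exact_mod_cast h3)
  exact (isUnit_nat_iff p).1 h4 (dvd_refl p)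

lemma Phi_e4 (hp10 : 10 < p) (v r1 r2 r3 r4 : ℤ_[p]) (hv : 24 * v = 1)
    (h1 : Ps p 1 = p * r1) (h2 : Ps p 2 = p * r2) (h3 : Ps p 3 = p * r3) (h4 : Ps p 4 = p * r4)
    (c : ℕ) : (p : ℤ_[p]) ^ 10 ∣ Phi p c - e4 v (Lg p v r1 r2 r3 r4 ((c * (c + 1) : ℕ) : ℤ_[p])) := by
  set w : ℤ_[p] := ((c * (c + 1) : ℕ) : ℤ_[p]) with hw
  have e1 := prod_e4 v (p : ℤ_[p]) hv (fun a => w * cpair p a) p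
  rw [← Phi_sq] at e1
  have e2 : ∑ a ∈ range p, l4 v ((p : ℤ_[p]) ^ 2 * (w * cpair p a)) =
      2 * Lg p v r1 r2 r3 r4 w := by
    have : ∀ a, l4 v ((p : ℤ_[p]) ^ 2 * (w * cpair p a)) =
      (p : ℤ_[p]) ^ 2 * w * cpair p a ^ 1 - 12 * v * p ^ 4 * w ^ 2 * cpair p a ^ 2
       + 8 * v * p ^ 6 * w ^ 3 * cpair p a ^ 3 - 6 * v * p ^ 8 * w ^ 4 * cpair p a ^ 4 := by
      intro a; unfold l4; ring
    simp_rw [this]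
    rw [Finset.sum_sub_distrib, Finset.sum_add_distrib, Finset.sum_sub_distrib]
    simp_rw [← Finset.mul_sum]
    change _ * Ps p 1 - _ * Ps p 2 + _ * Ps p 3 - _ * Ps p 4 = _
    rw [h1, h2, h3, h4]
    unfold Lg
    linear_combination (-(p : ℤ_[p]) ^ 3 * w * r1) * hv
  rw [e2] at e1
  set L := Lg p v r1 r2 r3 r4 w with hL
  obtain ⟨M, hM⟩ : ∃ M, L = (p : ℤ_[p]) ^ 2 * M := by
    refine ⟨p * (12 * v * r1 * w) + (p : ℤ_[p]) ^ 3 * (-6 * v * r2 * w ^ 2)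
    + (p : ℤ_[p]) ^ 5 * (4 * v * r3 * w ^ 3) + (p : ℤ_[p]) ^ 7 * (-3 * v * r4 * w ^ 4), ?_⟩
    rw [hL]; unfold Lg; ring
  have e3 := e4_mul v (p : ℤ_[p]) M M hv
  rw [← hM, ← two_mul] at e3
  have e5 : (p : ℤ_[p]) ∣ e4 v L - 1 := by
    rw [hM]; unfold e4
    exact ⟨p * M + 12 * v * p ^ 3 * M ^ 2 + 4 * v * p ^ 5 * M ^ 3 + v * p ^ 7 * M ^ 4, by ring⟩
  have e6 : IsUnit (Phi p c + e4 v L) := by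
    apply isUnit_of_two hp10
    have := dvd_add (Phi_one_mod (p := p) c) e5
    convert this using 1; ring
  apply unit_dvd e6
  have := dvd_sub e1 e3
  convert this using 1; ring

/-- Cumulative products. -/
noncomputable def Psi (p : ℕ) [Fact p.Prime] (n : ℕ) : ℤ_[p] := ∏ c ∈ range n, Phi p c

/-- Cumulative sums of powers of c(c+1). -/
def sig (k n : ℕ) : ℤ := ∑ c ∈ range n, ((c : ℤ) * (c + 1)) ^ k

/-- Cumulative logs. -/
noncomputable def Ls (p : ℕ) [Fact p.Prime] (v r1 r2 r3 r4 : ℤ_[p]) (s1 s2 s3 s4 : ℤ_[p]) : ℤ_[p] :=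
  (p : ℤ_[p]) ^ 3 * (12 * v * r1 * s1) + (p : ℤ_[p]) ^ 5 * (-6 * v * r2 * s2)
    + (p : ℤ_[p]) ^ 7 * (4 * v * r3 * s3) + (p : ℤ_[p]) ^ 9 * (-3 * v * r4 * s4)

lemma Ls_add (v r1 r2 r3 r4 s1 s2 s3 s4 t1 t2 t3 t4 : ℤ_[p]) :
    Ls p v r1 r2 r3 r4 s1 s2 s3 s4 + Ls p v r1 r2 r3 r4 t1 t2 t3 t4 =
    Ls p v r1 r2 r3 r4 (s1 + t1) (s2 + t2) (s3 + t3) (s4 + t4) := by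
  unfold Ls; ring

lemma Ls_dvd (v r1 r2 r3 r4 s1 s2 s3 s4 : ℤ_[p]) :
    ∃ M, Ls p v r1 r2 r3 r4 s1 s2 s3 s4 = (p : ℤ_[p]) ^ 2 * M := by
  refine ⟨p * (12 * v * r1 * s1) + (p : ℤ_[p]) ^ 3 * (-6 * v * r2 * s2)
    + (p : ℤ_[p]) ^ 5 * (4 * v * r3 * s3) + (p : ℤ_[p]) ^ 7 * (-3 * v * r4 * s4), ?_⟩
  unfold Ls; ring

lemma Ls_mul (v r1 r2 r3 r4 s1 s2 s3 s4 t1 t2 t3 t4 : ℤ_[p]) (hv : 24 * v = 1) :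
    (p : ℤ_[p]) ^ 10 ∣ e4 v (Ls p v r1 r2 r3 r4 s1 s2 s3 s4) * e4 v (Ls p v r1 r2 r3 r4 t1 t2 t3 t4) -
    e4 v (Ls p v r1 r2 r3 r4 (s1 + t1) (s2 + t2) (s3 + t3) (s4 + t4)) := by
  rw [← Ls_add]
  obtain ⟨M, hM⟩ := Ls_dvd v r1 r2 r3 r4 s1 s2 s3 s4
  obtain ⟨N, hN⟩ := Ls_dvd v r1 r2 r3 r4 t1 t2 t3 t4
  rw [hM, hN]
  exact e4_mul v _ M N hv

lemma Psi_e4 (hp10 : 10 < p) (v r1 r2 r3 r4 : ℤ_[p]) (hv : 24 * v = 1)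
    (h1 : Ps p 1 = p * r1) (h2 : Ps p 2 = p * r2) (h3 : Ps p 3 = p * r3) (h4 : Ps p 4 = p * r4)
    (n : ℕ) : (p : ℤ_[p]) ^ 10 ∣ Psi p n -
      e4 v (Ls p v r1 r2 r3 r4 (sig 1 n : ℤ) (sig 2 n : ℤ) (sig 3 n : ℤ) (sig 4 n : ℤ)) := by
  induction n with
  | zero => simp [Psi, sig, Ls, e4]
  | succ n ih =>
    have hs : ∀ k, ((sig k (n + 1) : ℤ) : ℤ_[p]) = (sig k n : ℤ) + ((n * (n + 1) : ℕ) : ℤ_[p]) ^ k := by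
      intro k
      unfold sig
      rw [Finset.sum_range_succ]
      push_cast; rfl
    rw [hs, hs, hs, hs]
    obtain ⟨c1, e1⟩ := ih
    obtain ⟨c2, e2⟩ := Phi_e4 hp10 v r1 r2 r3 r4 hv h1 h2 h3 h4 n
    set w : ℤ_[p] := ((n * (n + 1) : ℕ) : ℤ_[p])
    obtain ⟨c3, e3⟩ := Ls_mul v r1 r2 r3 r4 (sig 1 n : ℤ) (sig 2 n : ℤ) (sig 3 n : ℤ) (sig 4 n : ℤ) (w ^ 1) (w ^ 2) (w ^ 3) (w ^ 4) hv
    have hL : Lg p v r1 r2 r3 r4 w = Ls p v r1 r2 r3 r4 (w ^ 1) (w ^ 2) (w ^ 3) (w ^ 4) := by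
      unfold Lg Ls; ring
    rw [hL] at e2
    have : Psi p (n + 1) = Psi p n * Phi p n := by unfold Psi; rw [Finset.prod_range_succ]
    rw [this]
    set A := e4 v (Ls p v r1 r2 r3 r4 (sig 1 n : ℤ) (sig 2 n : ℤ) (sig 3 n : ℤ) (sig 4 n : ℤ))
    exact ⟨c1 * Phi p n + A * c2 + c3, by linear_combination Phi p n * e1 + A * e2 + e3⟩

lemma factorial_Psi (n : ℕ) :
    ((p * n).factorial : ℤ_[p]) = p ^ n * n.factorial * ((p - 1).factorial : ℤ_[p]) ^ n * Psi p n := by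
  have hpp : p.Prime := Fact.out
  induction n with
  | zero => simp [Psi]
  | succ n ih =>
    have h1 : (p * (n + 1)).factorial = (p * n).factorial * ∏ i ∈ range p, (p * n + 1 + i) := by
      rw [← Nat.ascFactorial_eq_prod_range, Nat.factorial_mul_ascFactorial, Nat.mul_succ]
    obtain ⟨m, hm⟩ : ∃ m, p = m + 1 := ⟨p - 1, by have := hpp.pos; omega⟩
    have h2 : ((∏ i ∈ range p, (p * n + 1 + i) : ℕ) : ℤ_[p]) =
        ((p - 1).factorial : ℤ_[p]) * Phi p n * (p * (n + 1 : ℕ)) := by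
      have h3 : Phi p n = ∏ i ∈ range (p - 1), (1 + p * n * iv p (i + 1)) := by
        unfold Phi
        have : range p = range (p - 1 + 1) := by congr 1; omega
        rw [this, Finset.prod_range_succ', iv_zero]
        simp
      have h4 : (∏ i ∈ range p, (p * n + 1 + i) : ℕ) =
          (∏ i ∈ range (p - 1), (p * n + 1 + i)) * (p * (n + 1)) := by
        have : range p = range (p - 1 + 1) := by congr 1; omega
        rw [this, Finset.prod_range_succ]
        congr 1
        rw [mul_add]; omega
      rw [h4, h3, ← Finset.prod_range_add_one_eq_factorial]
      push_cast
      rw [← Finset.prod_mul_distrib]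
      congr 1
      refine Finset.prod_congr rfl fun i hi => ?_
      have hi' := Finset.mem_range.1 hi
      have h5 : ¬ p ∣ (i + 1) := fun h => by have := Nat.le_of_dvd (by omega) h; omega
      have h6 := mul_iv h5
      push_cast at h6
      linear_combination (-(p : ℤ_[p]) * n) * h6
    rw [h1, Nat.cast_mul, ih, h2, Nat.factorial_succ]
    unfold Psi
    rw [Finset.prod_range_succ]
    push_cast
    ring

lemma choose_Psi (j i : ℕ) (h : i ≤ j) :
    ((p * j).choose (p * i) : ℤ_[p]) * (Psi p i * Psi p (j - i)) = (j.choose i : ℤ_[p]) * Psi p j := by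
  have hpp : p.Prime := Fact.out
  have e1 : ((p * j).choose (p * i) : ℤ_[p]) * ((p * i).factorial : ℤ_[p]) *
      ((p * (j - i)).factorial : ℤ_[p]) = ((p * j).factorial : ℤ_[p]) := by
    have := Nat.choose_mul_factorial_mul_factorial (Nat.mul_le_mul_left p h)
    rw [← Nat.mul_sub] at this
    exact_mod_cast this
  have e2 : (j.choose i : ℤ_[p]) * (i.factorial : ℤ_[p]) * ((j - i).factorial : ℤ_[p]) =
      (j.factorial : ℤ_[p]) := by
    exact_mod_cast Nat.choose_mul_factorial_mul_factorial h
  rw [factorial_Psi, factorial_Psi, factorial_Psi, ← e2] at e1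
  have hj : ∀ x : ℤ_[p], x ^ i * x ^ (j - i) = x ^ j := by
    intro x; rw [← pow_add]; congr 1; omega
  have hK : (p : ℤ_[p]) ^ j * i.factorial * (j - i).factorial * ((p - 1).factorial : ℤ_[p]) ^ j ≠ 0 := by
    have f0 : ∀ n : ℕ, (n.factorial : ℤ_[p]) ≠ 0 := fun n => by
      exact_mod_cast Nat.factorial_ne_zero n
    have hp0 : (p : ℤ_[p]) ≠ 0 := by exact_mod_cast hpp.ne_zero
    exact mul_ne_zero (mul_ne_zero (mul_ne_zero (pow_ne_zero _ hp0) (f0 _)) (f0 _)) (pow_ne_zero _ (f0 _))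
  apply mul_left_cancel₀ hK
  rw [← hj (p : ℤ_[p]), ← hj ((p - 1).factorial : ℤ_[p])] at *
  linear_combination e1

/-- Differences of cumulative sums. -/
def tau (k j i : ℕ) : ℤ := sig k j - sig k i - sig k (j - i)

lemma choose_e4 (hp10 : 10 < p) (v r1 r2 r3 r4 : ℤ_[p]) (hv : 24 * v = 1)
    (h1 : Ps p 1 = p * r1) (h2 : Ps p 2 = p * r2) (h3 : Ps p 3 = p * r3) (h4 : Ps p 4 = p * r4)
    (j i : ℕ) (h : i ≤ j) : (p : ℤ_[p]) ^ 10 ∣ ((p * j).choose (p * i) : ℤ_[p]) -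
      (j.choose i : ℤ_[p]) * e4 v (Ls p v r1 r2 r3 r4 (tau 1 j i : ℤ) (tau 2 j i : ℤ) (tau 3 j i : ℤ) (tau 4 j i : ℤ)) := by
  have e := choose_Psi (p := p) j i h
  obtain ⟨c1, e1⟩ := Psi_e4 hp10 v r1 r2 r3 r4 hv h1 h2 h3 h4 i
  obtain ⟨c2, e2⟩ := Psi_e4 hp10 v r1 r2 r3 r4 hv h1 h2 h3 h4 (j - i)
  obtain ⟨c3, e3⟩ := Psi_e4 hp10 v r1 r2 r3 r4 hv h1 h2 h3 h4 j
  obtain ⟨c4, e4'⟩ := Ls_mul v r1 r2 r3 r4 (sig 1 i : ℤ) (sig 2 i : ℤ) (sig 3 i : ℤ) (sig 4 i : ℤ)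
    (sig 1 (j - i) : ℤ) (sig 2 (j - i) : ℤ) (sig 3 (j - i) : ℤ) (sig 4 (j - i) : ℤ) hv
  have hneg : ∀ k, ((tau k j i : ℤ) : ℤ_[p]) =
      ((sig k j : ℤ) : ℤ_[p]) + -(((sig k i : ℤ) : ℤ_[p]) + ((sig k (j - i) : ℤ) : ℤ_[p])) := by
    intro k; unfold tau; push_cast; ring
  rw [hneg, hneg, hneg, hneg]
  set A1 := ((sig 1 i : ℤ) : ℤ_[p]) + ((sig 1 (j - i) : ℤ) : ℤ_[p])
  set A2 := ((sig 2 i : ℤ) : ℤ_[p]) + ((sig 2 (j - i) : ℤ) : ℤ_[p])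
  set A3 := ((sig 3 i : ℤ) : ℤ_[p]) + ((sig 3 (j - i) : ℤ) : ℤ_[p])
  set A4 := ((sig 4 i : ℤ) : ℤ_[p]) + ((sig 4 (j - i) : ℤ) : ℤ_[p])
  obtain ⟨c5, e5⟩ := Ls_mul v r1 r2 r3 r4 (sig 1 j : ℤ) (sig 2 j : ℤ) (sig 3 j : ℤ) (sig 4 j : ℤ)
    (-A1) (-A2) (-A3) (-A4) hv
  obtain ⟨c6, e6⟩ := Ls_mul v r1 r2 r3 r4 A1 A2 A3 A4 (-A1) (-A2) (-A3) (-A4) hv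
  have e7 : e4 v (Ls p v r1 r2 r3 r4 (A1 + -A1) (A2 + -A2) (A3 + -A3) (A4 + -A4)) = 1 := by
    simp [Ls, e4]
  rw [e7] at e6
  set N := e4 v (Ls p v r1 r2 r3 r4 (-A1) (-A2) (-A3) (-A4))
  set EA := e4 v (Ls p v r1 r2 r3 r4 A1 A2 A3 A4)
  set Ei := e4 v (Ls p v r1 r2 r3 r4 (sig 1 i : ℤ) (sig 2 i : ℤ) (sig 3 i : ℤ) (sig 4 i : ℤ))
  set Ek := e4 v (Ls p v r1 r2 r3 r4 (sig 1 (j - i) : ℤ) (sig 2 (j - i) : ℤ) (sig 3 (j - i) : ℤ) (sig 4 (j - i) : ℤ))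
  set Ej := e4 v (Ls p v r1 r2 r3 r4 (sig 1 j : ℤ) (sig 2 j : ℤ) (sig 3 j : ℤ) (sig 4 j : ℤ))
  set C := ((p * j).choose (p * i) : ℤ_[p])
  set D := (j.choose i : ℤ_[p])
  set X := e4 v (Ls p v r1 r2 r3 r4 ((sig 1 j : ℤ) + -A1) ((sig 2 j : ℤ) + -A2) ((sig 3 j : ℤ) + -A3) ((sig 4 j : ℤ) + -A4))
  refine ⟨-C * c6 - N * C * c4 - N * C * (c1 * Psi p (j - i) + Ei * c2) + N * D * c3 + D * c5, ?_⟩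
  linear_combination (-C) * e6 - N * C * e4' - N * C * Psi p (j - i) * e1 - N * C * Ei * e2 + N * e + N * D * e3 + D * e5

lemma choose_main (hp10 : 10 < p) (v r1 r2 r3 r4 : ℤ_[p]) (hv : 24 * v = 1)
    (h1 : Ps p 1 = p * r1) (h2 : Ps p 2 = p * r2) (h3 : Ps p 3 = p * r3) (h4 : Ps p 4 = p * r4)
    (x1 x2 x3 x4 : ℤ_[p]) (hx1 : x1 = 12 * v * r1) (hx2 : x2 = -6 * v * r2) (hx3 : x3 = 4 * v * r3)
    (hx4 : x4 = -3 * v * r4) (P : ℤ_[p]) (hP : P = p) (j i : ℕ) :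
    P ^ 10 ∣ ((p * j).choose (p * i) : ℤ_[p]) -
      (j.choose i : ℤ_[p]) * (1 + P ^ 3 * x1 * (tau 1 j i : ℤ) + P ^ 5 * x2 * (tau 2 j i : ℤ)
        + P ^ 7 * x3 * (tau 3 j i : ℤ) + P ^ 9 * x4 * (tau 4 j i : ℤ)
        + 12 * v * P ^ 6 * x1 ^ 2 * (tau 1 j i : ℤ) ^ 2
        + 24 * v * P ^ 8 * x1 * x2 * ((tau 1 j i : ℤ) * (tau 2 j i : ℤ))
        + 4 * v * P ^ 9 * x1 ^ 3 * (tau 1 j i : ℤ) ^ 3) := by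
  have hpp : p.Prime := Fact.out
  by_cases h : i ≤ j
  · obtain ⟨c, hc⟩ := choose_e4 hp10 v r1 r2 r3 r4 hv h1 h2 h3 h4 j i h
    obtain ⟨d, hd⟩ := e4_expand v P (x1 * (tau 1 j i : ℤ)) (x2 * (tau 2 j i : ℤ)) (x3 * (tau 3 j i : ℤ)) (x4 * (tau 4 j i : ℤ))
    unfold Ls at hc
    rw [← hP, ← hx1, ← hx2, ← hx3, ← hx4] at hc
    refine ⟨c + (j.choose i : ℤ_[p]) * d, ?_⟩
    linear_combination hc + (j.choose i : ℤ_[p]) * hd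
  · rw [Nat.choose_eq_zero_of_lt (by omega : j < i),
      Nat.choose_eq_zero_of_lt (Nat.mul_lt_mul_of_pos_left (by omega : j < i) hpp.pos)]
    simp

end expo

section base
variable {p : ℕ} [Fact p.Prime]
open Polynomial in
lemma coeff_one_sub_pow {R : Type*} [CommRing R] (n k : ℕ) :
    ((1 - X : R[X]) ^ n).coeff k = (-1) ^ k * (n.choose k : R) := by
  have h : (1 - X : R[X]) ^ n = ((1 + X) ^ n).comp (C (-1) * X) := by
    simp [sub_eq_add_neg]
  rw [h, Polynomial.comp_C_mul_X_coeff, Polynomial.coeff_one_add_X_pow, mul_comm]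

lemma choose_pred_mod (a : ℕ) (ha : a < p) :
    (p : ℤ_[p]) ∣ ((p - 1).choose a : ℤ_[p]) - (-1) ^ a := by
  have hpp : p.Prime := Fact.out
  induction a with
  | zero => simp
  | succ a ih =>
    obtain ⟨c, hc⟩ := ih (by omega)
    have h1 : (p : ℤ_[p]) ∣ (p.choose (a + 1) : ℤ_[p]) := by
      have := hpp.dvd_choose_self (Nat.succ_ne_zero a) ha
      exact_mod_cast Nat.cast_dvd_cast (α := ℤ_[p]) this
    obtain ⟨d, hd⟩ := h1
    have h2 : p.choose (a + 1) = (p - 1).choose a + (p - 1).choose (a + 1) := by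
      obtain ⟨m, rfl⟩ : ∃ m, p = m + 1 := ⟨p - 1, by omega⟩
      simp [Nat.choose_succ_succ]
    rw [h2] at hd
    push_cast at hd
    exact ⟨d - c, by rw [pow_succ]; linear_combination hd - hc⟩

lemma choose_iv (a : ℕ) (h0 : a ≠ 0) (ha : a < p) :
    (p : ℤ_[p]) ^ 2 ∣ -((-1) ^ a * (p.choose a : ℤ_[p])) - p * iv p a := by
  have h1 : ¬ p ∣ a := fun h => by have := Nat.le_of_dvd (by omega) h; omega
  obtain ⟨b, rfl⟩ : ∃ b, a = b + 1 := ⟨a - 1, by omega⟩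
  apply dvd_of_nat_mul h1
  obtain ⟨c, hc⟩ := choose_pred_mod (p := p) b (by omega)
  have h2 : ((b + 1 : ℕ) : ℤ_[p]) * (p.choose (b + 1) : ℤ_[p]) = p * ((p - 1).choose b : ℤ_[p]) := by
    have h3 : p - 1 + 1 = p := by omega
    have := Nat.add_one_mul_choose_eq (p - 1) b
    rw [h3] at this
    rw [mul_comm]
    exact_mod_cast this.symm
  have h4 := mul_iv h1
  have h5 : (-1 : ℤ_[p]) ^ b * (-1) ^ b = 1 := by rw [← mul_pow]; simp
  refine ⟨(-1) ^ b * c, ?_⟩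
  rw [pow_succ]
  linear_combination (-1) ^ b * h2 + p * (-1) ^ b * hc - p * h4 + p * h5

open Polynomial in
/-- The auxiliary polynomial approximating p times f. -/
noncomputable def Gp (p : ℕ) [Fact p.Prime] : ℤ_[p][X] := (1 - X ^ p) - (1 - X) ^ p

open Polynomial in
lemma Gp_approx (hp10 : 10 < p) : C ((p : ℤ_[p]) ^ 2) ∣ Gp p - C (p : ℤ_[p]) * fpoly p 1 p := by
  have hpp : p.Prime := Fact.out
  have hodd : Odd p := hpp.odd_of_ne_two (by omega)
  rw [Polynomial.C_dvd_iff_dvd_coeff]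
  intro n
  unfold Gp
  rw [Polynomial.coeff_sub, Polynomial.coeff_sub, Polynomial.coeff_sub, coeff_one_sub_pow,
    Polynomial.coeff_C_mul, fpoly_coeff, Polynomial.coeff_X_pow, Polynomial.coeff_one, pow_one]
  by_cases h0 : n = 0
  · subst h0
    rw [iv_zero, if_neg hpp.ne_zero.symm]
    simp
  rw [if_neg h0]
  rcases lt_trichotomy n p with h | h | h
  · rw [if_neg h.ne, if_pos h]
    have := choose_iv n h0 h
    convert this using 1; ring
  · subst h
    rw [if_pos rfl, if_neg (lt_irrefl _), hodd.neg_one_pow]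
    simp
  · rw [if_neg h.ne', if_neg (by omega), Nat.choose_eq_zero_of_lt h]
    simp

open Polynomial in
lemma Gp_coeff (hp10 : 10 < p) (n : ℕ) :
    (p : ℤ_[p]) ^ 10 ∣ (Gp p ^ 9).coeff n - (p : ℤ_[p]) ^ 9 * (fpoly p 1 p ^ 9).coeff n := by
  obtain ⟨h, hh⟩ := Gp_approx hp10
  rw [← Polynomial.coeff_C_mul, ← Polynomial.coeff_sub]
  refine (Polynomial.C_dvd_iff_dvd_coeff _ _).1 ?_ n
  have e : Gp p = C (p : ℤ_[p]) * (fpoly p 1 p + C (p : ℤ_[p]) * h) := by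
    rw [C_pow] at hh; linear_combination hh
  have e2 := sub_dvd_pow_sub_pow (fpoly p 1 p + C (p : ℤ_[p]) * h) (fpoly p 1 p) 9
  rw [add_sub_cancel_left] at e2
  obtain ⟨w, hw⟩ := e2
  refine ⟨h * w, ?_⟩
  rw [e, C_pow, C_pow, mul_pow]
  linear_combination C (p : ℤ_[p]) ^ 9 * hw

/-- Integer weights of the expansion. -/
def wt {R : Type*} [CommRing R] (F : ℕ → ℕ → R) (s : ℕ) : R :=
  ∑ j ∈ range 10, ∑ t ∈ range (10 - j),
    if t ≤ s then ((-1) ^ (j + s) * ((Nat.choose 9 j * Nat.choose (9 - j) t : ℕ) : R)) * F j (s - t) else 0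

open Polynomial in
lemma Gp_coeff_eq (hp10 : 10 < p) (s : ℕ) :
    (Gp p ^ 9).coeff (s * p) = wt (fun j i => ((p * j).choose (p * i) : ℤ_[p])) s := by
  have hpp : p.Prime := Fact.out
  have hodd : Odd p := hpp.odd_of_ne_two (by omega)
  unfold Gp wt
  rw [sub_eq_neg_add, add_pow, Polynomial.finsetSum_coeff]
  refine Finset.sum_congr rfl fun j hj => ?_
  have hj' := Finset.mem_range.1 hj
  have e : (1 - X ^ p : ℤ_[p][X]) ^ (9 - j) =
      ∑ t ∈ range (10 - j), C ((-1) ^ t * (Nat.choose (9 - j) t : ℤ_[p])) * X ^ (p * t) := by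
    rw [sub_eq_neg_add, add_pow]
    have : 9 - j + 1 = 10 - j := by omega
    rw [this]
    refine Finset.sum_congr rfl fun t _ => ?_
    rw [neg_pow, ← pow_mul]
    simp
    ring
  have e2 : (-(1 - X : ℤ_[p][X]) ^ p) ^ j = C ((-1) ^ j) * (1 - X) ^ (p * j) := by
    rw [neg_pow, pow_mul]; simp
  rw [e, e2, Finset.mul_sum, Finset.sum_mul, Polynomial.finsetSum_coeff]
  refine Finset.sum_congr rfl fun t _ => ?_
  have e3 : C ((-1) ^ j) * (1 - X) ^ (p * j) * (C ((-1) ^ t * (Nat.choose (9 - j) t : ℤ_[p])) * X ^ (p * t)) * (Nat.choose 9 j : ℤ_[p][X])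
    = C ((-1) ^ j * ((-1) ^ t * (Nat.choose (9 - j) t : ℤ_[p])) * (Nat.choose 9 j : ℤ_[p])) * ((1 - X) ^ (p * j) * X ^ (p * t)) := by
    simp only [C_mul, Polynomial.C_eq_natCast]
    ring
  rw [e3, Polynomial.coeff_C_mul, Polynomial.coeff_mul_X_pow']
  have hc : (p * t ≤ s * p) ↔ t ≤ s := by
    rw [mul_comm s p]; exact Nat.mul_le_mul_left_iff hpp.pos
  by_cases hts : t ≤ s
  · rw [if_pos (hc.2 hts), if_pos hts, coeff_one_sub_pow, mul_comm s p, ← Nat.mul_sub, pow_mul,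
      hodd.neg_one_pow]
    have h6 : (-1 : ℤ_[p]) ^ t * (-1) ^ (s - t) = (-1) ^ s := by
      rw [← pow_add]; congr 1; omega
    rw [pow_add, ← h6]
    push_cast
    ring
  · rw [if_neg (fun h => hts (hc.1 h)), if_neg hts, mul_zero]

/-- Weighted total. -/
def Wt {R : Type*} [CommRing R] (F : ℕ → ℕ → R) : R :=
  ∑ s ∈ range 8, (Ew s : R) * wt F (s + 1)

lemma wt_add {R : Type*} [CommRing R] (F G : ℕ → ℕ → R) (s : ℕ) :
    wt (fun j i => F j i + G j i) s = wt F s + wt G s := by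
  unfold wt
  rw [← Finset.sum_add_distrib]
  refine Finset.sum_congr rfl fun j _ => ?_
  rw [← Finset.sum_add_distrib]
  refine Finset.sum_congr rfl fun t _ => ?_
  split_ifs <;> ring

lemma wt_mul {R : Type*} [CommRing R] (c : R) (F : ℕ → ℕ → R) (s : ℕ) :
    wt (fun j i => c * F j i) s = c * wt F s := by
  unfold wt
  rw [Finset.mul_sum]
  refine Finset.sum_congr rfl fun j _ => ?_
  rw [Finset.mul_sum]
  refine Finset.sum_congr rfl fun t _ => ?_
  split_ifs <;> ring

lemma wt_dvd {R : Type*} [CommRing R] (c : R) (F : ℕ → ℕ → R) (h : ∀ j i, c ∣ F j i) (s : ℕ) :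
    c ∣ wt F s := by
  unfold wt
  refine Finset.dvd_sum fun j _ => Finset.dvd_sum fun t _ => ?_
  split_ifs
  · exact Dvd.dvd.mul_left (h _ _) _
  · exact dvd_zero _

lemma wt_cast {R : Type*} [CommRing R] (F : ℕ → ℕ → ℤ) (s : ℕ) :
    wt (fun j i => ((F j i : ℤ) : R)) s = ((wt F s : ℤ) : R) := by
  unfold wt
  push_cast
  refine Finset.sum_congr rfl fun j _ => Finset.sum_congr rfl fun t _ => ?_
  split_ifs <;> simp

lemma Wt_add {R : Type*} [CommRing R] (F G : ℕ → ℕ → R) :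
    Wt (fun j i => F j i + G j i) = Wt F + Wt G := by
  unfold Wt
  rw [← Finset.sum_add_distrib]
  refine Finset.sum_congr rfl fun j _ => ?_
  rw [wt_add]; ring

lemma Wt_mul {R : Type*} [CommRing R] (c : R) (F : ℕ → ℕ → R) :
    Wt (fun j i => c * F j i) = c * Wt F := by
  unfold Wt
  rw [Finset.mul_sum]
  refine Finset.sum_congr rfl fun j _ => ?_
  rw [wt_mul]; ring

lemma Wt_dvd {R : Type*} [CommRing R] (c : R) (F : ℕ → ℕ → R) (h : ∀ j i, c ∣ F j i) :
    c ∣ Wt F := by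
  unfold Wt
  exact Finset.dvd_sum fun j _ => Dvd.dvd.mul_left (wt_dvd c F h _) _

lemma Wt_cast {R : Type*} [CommRing R] (F : ℕ → ℕ → ℤ) :
    Wt (fun j i => ((F j i : ℤ) : R)) = ((Wt F : ℤ) : R) := by
  unfold Wt
  push_cast
  refine Finset.sum_congr rfl fun j _ => ?_
  rw [wt_cast]

lemma EU_Wt (hp10 : 10 < p) :
    (p : ℤ_[p]) ^ 10 ∣ Wt (fun j i => ((p * j).choose (p * i) : ℤ_[p])) - (p : ℤ_[p]) ^ 9 * EU p p := by
  unfold Wt EU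
  rw [Finset.mul_sum, ← Finset.sum_sub_distrib]
  refine Finset.dvd_sum fun s _ => ?_
  have := Gp_coeff hp10 ((s + 1) * p)
  rw [Gp_coeff_eq hp10] at this
  have h := Dvd.dvd.mul_left this (Ew s : ℤ_[p])
  unfold Uc
  convert h using 1
  ring

end base

lemma Wt_n1 : Wt (fun j i => (j.choose i : ℤ) * 1) = 0 := by rfl
lemma Wt_n2 : Wt (fun j i => (j.choose i : ℤ) * tau 1 j i) = 0 := by rfl
lemma Wt_n3 : Wt (fun j i => (j.choose i : ℤ) * tau 2 j i) = 0 := by rfl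
lemma Wt_n4 : Wt (fun j i => (j.choose i : ℤ) * tau 3 j i) = 0 := by rfl
lemma Wt_n5 : Wt (fun j i => (j.choose i : ℤ) * tau 4 j i) = 8836853760 := by rfl
lemma Wt_n6 : Wt (fun j i => (j.choose i : ℤ) * tau 1 j i ^ 2) = 0 := by rfl
lemma Wt_n7 : Wt (fun j i => (j.choose i : ℤ) * (tau 1 j i * tau 2 j i)) = 0 := by rfl
lemma Wt_n8 : Wt (fun j i => (j.choose i : ℤ) * tau 1 j i ^ 3) = 487710720 := by rfl

section final
variable {p : ℕ} [Fact p.Prime]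

lemma EU_eval (hp10 : 10 < p) (v r1 r2 r3 r4 : ℤ_[p]) (hv : 24 * v = 1)
    (h1 : Ps p 1 = p * r1) (h2 : Ps p 2 = p * r2) (h3 : Ps p 3 = p * r3) (h4 : Ps p 4 = p * r4) :
    (p : ℤ_[p]) ∣ EU p p - (8836853760 * (-3 * v * r4) + 487710720 * (4 * v * (12 * v * r1) ^ 3)) := by
  have hpp : p.Prime := Fact.out
  have hp0 : (p : ℤ_[p]) ≠ 0 := by exact_mod_cast hpp.ne_zero
  obtain ⟨x1, hx1⟩ : ∃ x, x = 12 * v * r1 := ⟨_, rfl⟩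
  obtain ⟨x2, hx2⟩ : ∃ x, x = -6 * v * r2 := ⟨_, rfl⟩
  obtain ⟨x3, hx3⟩ : ∃ x, x = 4 * v * r3 := ⟨_, rfl⟩
  obtain ⟨x4, hx4⟩ : ∃ x, x = -3 * v * r4 := ⟨_, rfl⟩
  obtain ⟨P, hP⟩ : ∃ x, x = (p : ℤ_[p]) := ⟨_, rfl⟩
  have hc := choose_main hp10 v r1 r2 r3 r4 hv h1 h2 h3 h4 x1 x2 x3 x4 hx1 hx2 hx3 hx4 P hP
  have hd := Wt_dvd (P ^ 10) _ hc
  have hE := EU_Wt hp10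
  rw [← hP] at hE hp0 ⊢
  rw [← hx1, ← hx4]
  have hrw : (fun j i => ((p * j).choose (p * i) : ℤ_[p])) = fun j i =>
     ((((p * j).choose (p * i) : ℤ_[p]) -
      (j.choose i : ℤ_[p]) * (1 + P ^ 3 * x1 * (tau 1 j i : ℤ) + P ^ 5 * x2 * (tau 2 j i : ℤ)
        + P ^ 7 * x3 * (tau 3 j i : ℤ) + P ^ 9 * x4 * (tau 4 j i : ℤ)
        + 12 * v * P ^ 6 * x1 ^ 2 * (tau 1 j i : ℤ) ^ 2
        + 24 * v * P ^ 8 * x1 * x2 * ((tau 1 j i : ℤ) * (tau 2 j i : ℤ))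
        + 4 * v * P ^ 9 * x1 ^ 3 * (tau 1 j i : ℤ) ^ 3)) +
      (1 * (((j.choose i : ℤ) * 1 : ℤ) : ℤ_[p]) +
      ((P ^ 3 * x1) * (((j.choose i : ℤ) * tau 1 j i : ℤ) : ℤ_[p]) +
      ((P ^ 5 * x2) * (((j.choose i : ℤ) * tau 2 j i : ℤ) : ℤ_[p]) +
      ((P ^ 7 * x3) * (((j.choose i : ℤ) * tau 3 j i : ℤ) : ℤ_[p]) +
      ((P ^ 9 * x4) * (((j.choose i : ℤ) * tau 4 j i : ℤ) : ℤ_[p]) +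
      ((12 * v * P ^ 6 * x1 ^ 2) * (((j.choose i : ℤ) * tau 1 j i ^ 2 : ℤ) : ℤ_[p]) +
      ((24 * v * P ^ 8 * x1 * x2) * (((j.choose i : ℤ) * (tau 1 j i * tau 2 j i) : ℤ) : ℤ_[p]) +
      (4 * v * P ^ 9 * x1 ^ 3) * (((j.choose i : ℤ) * tau 1 j i ^ 3 : ℤ) : ℤ_[p]))))))))) := by
    funext j i
    push_cast
    ring
  rw [hrw, Wt_add, Wt_add, Wt_add, Wt_add, Wt_add, Wt_add, Wt_add, Wt_add,
    Wt_mul, Wt_mul, Wt_mul, Wt_mul, Wt_mul, Wt_mul, Wt_mul, Wt_mul,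
    Wt_cast, Wt_cast, Wt_cast, Wt_cast, Wt_cast, Wt_cast, Wt_cast, Wt_cast,
    Wt_n1, Wt_n2, Wt_n3, Wt_n4, Wt_n5, Wt_n6, Wt_n7, Wt_n8] at hE
  have h9 := dvd_sub hd hE
  have h10 : P ^ 9 * P ∣ P ^ 9 * (EU p p - (8836853760 * x4 + 487710720 * (4 * v * x1 ^ 3))) := by
    rw [← pow_succ]
    convert h9 using 1
    push_cast
    ring
  exact (mul_dvd_mul_iff_left (pow_ne_zero 9 hp0)).1 h10

lemma EU_final (hp10 : 10 < p) :
    (p : ℤ_[p]) ∣ 3 * EU p p + 40320 * 32 * (2283 * bet p (p - 9) + 7 * bet p (p - 3) ^ 3) := by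
  obtain ⟨r1, r2, r3, r4, h1, h2, h3, h4, ⟨a, ha⟩, ⟨b, hb⟩⟩ := Ps_main hp10
  have hpp : p.Prime := Fact.out
  have h24 : ¬ p ∣ 24 := by
    have h := prime_not_dvd_factorial (p := p) hp10 4 (by norm_num)
    simpa [Nat.factorial] using h
  have hv := mul_iv h24
  push_cast at hv
  set v := iv p 24
  obtain ⟨c, hc⟩ := EU_eval hp10 v r1 r2 r3 r4 hv h1 h2 h3 h4
  have hv4 : 331776 * v ^ 4 = 1 := by
    have : (24 * v) ^ 4 = 1 := by rw [hv, one_pow]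
    linear_combination this
  set β := bet p (p - 3)
  set γ := bet p (p - 9)
  refine ⟨3 * c - 8836853760 * v * b + 3 * 487710720 * 256 * v ^ 4 * (9 * r1 ^ 2 - 6 * r1 * β + 4 * β ^ 2) * a, ?_⟩
  linear_combination 3 * hc - 8836853760 * v * hb - 2945617920 * γ * hv +
    3 * 487710720 * 256 * v ^ 4 * (9 * r1 ^ 2 - 6 * r1 * β + 4 * β ^ 2) * ha - 9031680 * β ^ 3 * hv4

end final

theorem stmt19 (r : ℕ) (hr : 2 ≤ r) (p : ℕ) (hp : p.Prime) (hp10 : 10 < p) :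
    padicCong p r
      (9 * sigmaSum p 9 1 (2 * p ^ r) + 36 * sigmaSum p 9 2 (2 * p ^ r) +
        84 * sigmaSum p 9 3 (2 * p ^ r) + 126 * sigmaSum p 9 4 (2 * p ^ r))
      (16 * (2283 * bernoulli (p - 9) + 7 * bernoulli (p - 3) ^ 3) * (p : ℚ) ^ (r - 1)) := by
  have : Fact p.Prime := ⟨hp⟩
  have hodd : p ≠ 2 := by omega
  obtain ⟨k, rfl⟩ : ∃ k, r = k + 1 := ⟨r - 1, by omega⟩
  have h2 : ¬ p ∣ 2 := fun h => by have := Nat.le_of_dvd (by omega) h; omega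
  have hst := sigma_total p (p ^ (k + 1)) hp hodd
  set T : ℚ := 9 * sigmaSum p 9 1 (2 * p ^ (k + 1)) + 36 * sigmaSum p 9 2 (2 * p ^ (k + 1)) +
        84 * sigmaSum p 9 3 (2 * p ^ (k + 1)) + 126 * sigmaSum p 9 4 (2 * p ^ (k + 1)) with hT
  obtain ⟨a1, ha1⟩ := main_induct (p := p) hp10 k (by omega) 1
  obtain ⟨a2, ha2⟩ := main_induct (p := p) hp10 k (by omega) 2
  rw [one_mul] at ha1
  set A1 := PowerSeries.coeff (p ^ (k + 1)) (Fser p ^ 9)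
  set A2 := PowerSeries.coeff (2 * p ^ (k + 1)) (Fser p ^ 9)
  have hm2 := mul_iv h2
  have hm2' := congrArg (fun x : ℤ_[p] => (x : ℚ_[p])) hm2
  simp only [PadicInt.coe_mul, PadicInt.coe_natCast, PadicInt.coe_one] at hm2'
  have hc2 : ((2 : ℤ_[p]) : ℚ_[p]) = 2 := by simpa using (PadicInt.coe_natCast (p := p) 2)
  have hc7 : ((7 : ℤ_[p]) : ℚ_[p]) = 7 := by simpa using (PadicInt.coe_natCast (p := p) 7)
  have hc16 : ((16 : ℤ_[p]) : ℚ_[p]) = 16 := by simpa using (PadicInt.coe_natCast (p := p) 16)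
  have hc2283 : ((2283 : ℤ_[p]) : ℚ_[p]) = 2283 := by
    simpa using (PadicInt.coe_natCast (p := p) 2283)
  apply padicCong_of_dvd (p := p) (r := k + 1) (X := iv p 2 * (A1 - 2 * A2))
    (Y := 16 * (2283 * bet p (p - 9) + 7 * bet p (p - 3) ^ 3) * (p : ℤ_[p]) ^ k)
  · have h := congrArg (fun x : ℚ => (x : ℚ_[p])) hst
    simp only [Rat.cast_mul, Rat.cast_sub, Rat.cast_ofNat] at h
    rw [coeff_FQ_pow_coe, coeff_FQ_pow_coe] at h
    push_cast at hm2' ⊢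
    rw [hc2]
    linear_combination (iv p 2 : ℚ_[p]) * h - (T : ℚ_[p]) * hm2'
  · push_cast
    rw [bet_coe _ (by omega), bet_coe _ (by omega), hc7, hc16, hc2283]
  · obtain ⟨c, hc⟩ := EU_final (p := p) hp10
    have hf := prime_not_dvd_factorial (p := p) hp10 8 (by norm_num)
    apply dvd_of_nat_mul hf
    apply dvd_of_nat_mul h2
    have hfe : ((Nat.factorial 8 : ℕ) : ℤ_[p]) = 40320 := by norm_num [Nat.factorial]
    rw [hfe]
    push_cast at *
    refine ⟨a1 - 2 * a2 - c, ?_⟩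
    linear_combination ha1 - 2 * ha2 - (p : ℤ_[p]) ^ k * hc + 40320 * (A1 - 2 * A2) * hm2
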